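/- arXiv:2010.12410 — 5 statements merged into one kernel-verified Lean document; each statement's English description precedes it below -/
import Mathlib

section
/- Let p be a prime and let μ be a partition of a positive integer N. Then there exists a unique partition ν of N such that: (i) every part of ν has multiplicity at most p−1, and (ii) for every positive integer k coprime to p, the sum ∑_{j≥0} k·p^j · (multiplicity of k·p^j in ν) equals ∑_{j≥0} k·p^j · (multiplicity of k·p^j in μ). -/
/-- Base-`p` expansions of a fixed length with digits less than `p` are unique. -/
theorem digits_eq_of_sum_eq {p : ℕ} :
    ∀ (n : ℕ) (c d : ℕ → ℕ), (∀ j, c j < p) → (∀ j, d j < p) →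
      ∑ j ∈ Finset.range n, p ^ j * c j = ∑ j ∈ Finset.range n, p ^ j * d j →
      ∀ j < n, c j = d j
  | 0, _, _, _, _, _ => by simp
  | n + 1, c, d, hc, hd, h => by
    have hp : 0 < p := (Nat.zero_le _).trans_lt (hc 0)
    simp only [Finset.sum_range_succ', pow_succ', mul_assoc, ← Finset.mul_sum, pow_zero,
      one_mul] at h
    have h0 : c 0 = d 0 := by
      have := congrArg (· % p) h
      simpa [Nat.mul_add_mod, Nat.mod_eq_of_lt (hc 0), Nat.mod_eq_of_lt (hd 0)] using this
    rw [h0] at h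
    have ih := digits_eq_of_sum_eq n (fun j => c (j + 1)) (fun j => d (j + 1))
      (fun j => hc _) (fun j => hd _) (Nat.eq_of_mul_eq_mul_left hp (Nat.add_right_cancel h))
    rintro (_ | j) hj
    · exact h0
    · exact ih j (Nat.lt_of_succ_lt_succ hj)

/-- The sum of the elements of `s` whose prime-to-`p` part is `k`. -/
def primeToPartSum (p k : ℕ) (s : Multiset ℕ) : ℕ :=
  (s.map fun x => if ordCompl[p] x = k then x else 0).sum

theorem primeToPartSum_add (p k : ℕ) (s t : Multiset ℕ) :
    primeToPartSum p k (s + t) = primeToPartSum p k s + primeToPartSum p k t := by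
  simp [primeToPartSum]

theorem primeToPartSum_cons (p k a : ℕ) (s : Multiset ℕ) :
    primeToPartSum p k (a ::ₘ s) =
      (if ordCompl[p] a = k then a else 0) + primeToPartSum p k s := by
  simp [primeToPartSum]

theorem ordCompl_mul_prime_pow {p k : ℕ} (hp : p.Prime) (hk : 0 < k) (hkp : k.Coprime p)
    (j : ℕ) : (k * p ^ j).factorization p = j ∧ ordCompl[p] (k * p ^ j) = k := by
  have h : (k * p ^ j).factorization p = j := by
    rw [Nat.factorization_mul hk.ne' (pow_pos hp.pos j).ne', Finsupp.add_apply,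
      Nat.factorization_eq_zero_of_not_dvd ((hp.coprime_iff_not_dvd).1 hkp.symm)]
    simp [hp.factorization_self]
  exact ⟨h, by rw [h, Nat.mul_div_cancel _ (pow_pos hp.pos j)]⟩

theorem factorization_lt_succ_of_le {p a N : ℕ} (ha : 0 < a) (haN : a ≤ N) :
    a.factorization p < N + 1 :=
  ((Nat.factorization_lt p ha.ne').trans_le haN).trans (Nat.lt_succ_self N)

theorem sum_range_mul_count_eq_primeToPartSum {p k N : ℕ} (hp : p.Prime) (hk : 0 < k)
    (hkp : k.Coprime p) (s : Multiset ℕ) (hs : ∀ x ∈ s, 0 < x ∧ x ≤ N) :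
    ∑ j ∈ Finset.range (N + 1), k * p ^ j * s.count (k * p ^ j) = primeToPartSum p k s := by
  induction s using Multiset.induction_on with
  | empty => simp [primeToPartSum]
  | cons a s ih =>
    rw [primeToPartSum_cons, ← ih fun x hx => hs x (Multiset.mem_cons_of_mem hx)]
    obtain ⟨ha, haN⟩ := hs a (Multiset.mem_cons_self a s)
    simp only [Multiset.count_cons, mul_add, Finset.sum_add_distrib]
    rw [add_comm]
    congr 1
    split_ifs with h
    · have hak : k * p ^ a.factorization p = a := by
        rw [← h, mul_comm]
        exact Nat.ordProj_mul_ordCompl_eq_self a p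
      rw [Finset.sum_eq_single (a.factorization p)]
      · simp [hak]
      · intro j _ hj
        rw [if_neg, mul_zero]
        rintro rfl
        exact hj (ordCompl_mul_prime_pow hp hk hkp j).1.symm
      · intro hj
        exact absurd (Finset.mem_range.2 (factorization_lt_succ_of_le ha haN)) hj
    · refine Finset.sum_eq_zero fun j _ => ?_
      rw [if_neg, mul_zero]
      rintro rfl
      exact h (ordCompl_mul_prime_pow hp hk hkp j).2

/-- Repeatedly replacing `p` copies of `m` by one copy of `p * m` terminates in a multiset with all
multiplicities less than `p`. -/
theorem exists_reduced_multiset {p : ℕ} (hp : p.Prime) (s : Multiset ℕ) (hs : ∀ x ∈ s, 0 < x) :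
    ∃ t : Multiset ℕ, (∀ x ∈ t, 0 < x) ∧ t.sum = s.sum ∧ (∀ m, t.count m ≤ p - 1) ∧
      ∀ k, primeToPartSum p k t = primeToPartSum p k s := by
  induction hn : s.card using Nat.strong_induction_on generalizing s with
  | _ n ih =>
    by_cases h : ∀ m, s.count m ≤ p - 1
    · exact ⟨s, hs, rfl, h, fun _ => rfl⟩
    · push Not at h
      obtain ⟨m, hm⟩ := h
      have hpm : p ≤ s.count m := by omega
      obtain ⟨u, rfl⟩ := Multiset.le_iff_exists_add.1 (Multiset.le_count_iff_replicate_le.1 hpm)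
      have hm0 : 0 < m :=
        hs m (Multiset.count_pos.1 (hp.pos.trans_le hpm))
      obtain ⟨t, ht, hsum, hcount, hpart⟩ := ih (p * m ::ₘ u).card
        (by
          have := hp.two_le
          simp only [Multiset.card_add, Multiset.card_replicate] at hn
          rw [Multiset.card_cons]
          omega)
        (p * m ::ₘ u)
        (by
          intro x hx
          rcases Multiset.mem_cons.1 hx with rfl | hx
          · exact Nat.mul_pos hp.pos hm0
          · exact hs x (Multiset.mem_add.2 (Or.inr hx)))
        rfl
      refine ⟨t, ht, by simp [hsum], hcount, fun k => ?_⟩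
      have hcompl : ordCompl[p] (p * m) = ordCompl[p] m := by
        rw [Nat.ordCompl_mul, hp.factorization_self, pow_one, Nat.div_self hp.pos, one_mul]
      rw [hpart, primeToPartSum_cons, primeToPartSum_add, hcompl]
      simp [primeToPartSum]


/-- Let `p` be a prime and `μ` a partition of a positive integer `N`.
Then there is a unique partition `ν` of `N` such that (i) every part of `ν` has multiplicity
at most `p − 1`, and (ii) for every positive integer `k` coprime to `p`, the sum
`∑_{j≥0} k·p^j·(multiplicity of k·p^j in ν)` equals the corresponding sum for `μ`.
(Since all parts are at most `N`, the sum over `j ∈ {0, …, N}` captures all nonzero terms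
of the sum over all `j ≥ 0`.) -/
theorem exists_unique_reduction (p : ℕ) (hp : p.Prime) (N : ℕ) (hN : 0 < N)
    (μ : Nat.Partition N) :
    ∃! ν : Nat.Partition N,
      (∀ m : ℕ, ν.parts.count m ≤ p - 1) ∧
      ∀ k : ℕ, 0 < k → Nat.Coprime k p →
        ∑ j ∈ Finset.range (N + 1), k * p ^ j * ν.parts.count (k * p ^ j) =
          ∑ j ∈ Finset.range (N + 1), k * p ^ j * μ.parts.count (k * p ^ j) := by
  have hbound (ν : Nat.Partition N) : ∀ x ∈ ν.parts, 0 < x ∧ x ≤ N := fun x hx =>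
    ⟨ν.parts_pos hx, (Multiset.le_sum_of_mem hx).trans_eq ν.parts_sum⟩
  obtain ⟨t, ht, hsum, hcount, hpart⟩ :=
    exists_reduced_multiset hp μ.parts fun x hx => μ.parts_pos hx
  refine ⟨⟨t, fun hx => ht _ hx, hsum.trans μ.parts_sum⟩, ⟨hcount, fun k hk hkp => ?_⟩, ?_⟩
  · rw [sum_range_mul_count_eq_primeToPartSum hp hk hkp _ (hbound _),
      sum_range_mul_count_eq_primeToPartSum hp hk hkp _ (hbound μ), hpart]
  rintro ν ⟨hν, hνsum⟩
  have hlt {c : ℕ} (hc : c ≤ p - 1) : c < p := by have := hp.pos; omega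
  have hbt := hbound ⟨t, fun hx => ht _ hx, hsum.trans μ.parts_sum⟩
  ext m
  change ν.parts.count m = t.count m
  by_cases hm : 0 < m ∧ m ≤ N
  · have hk : 0 < ordCompl[p] m := Nat.ordCompl_pos p hm.1.ne'
    have hkp : (ordCompl[p] m).Coprime p := (Nat.coprime_ordCompl hp hm.1.ne').symm
    have hmk : ordCompl[p] m * p ^ m.factorization p = m := by
      rw [mul_comm]
      exact Nat.ordProj_mul_ordCompl_eq_self m p
    have h := hνsum _ hk hkp
    rw [sum_range_mul_count_eq_primeToPartSum hp hk hkp _ (hbound μ), ← hpart,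
      ← sum_range_mul_count_eq_primeToPartSum hp hk hkp t hbt] at h
    generalize ordCompl[p] m = k at *
    simp only [mul_assoc, ← Finset.mul_sum] at h
    have hdigit := digits_eq_of_sum_eq (N + 1) (fun j => ν.parts.count (k * p ^ j))
      (fun j => t.count (k * p ^ j)) (fun j => hlt (hν _)) (fun j => hlt (hcount _))
      (Nat.eq_of_mul_eq_mul_left hk h) _ (factorization_lt_succ_of_le (p := p) hm.1 hm.2)
    simpa only [hmk] using hdigit
  · rw [Multiset.count_eq_zero_of_notMem fun h => hm (hbound ν m h),
      Multiset.count_eq_zero_of_notMem fun h => hm (hbt m h)]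
end

section
/- Let p be a prime, let μ be a partition of a positive integer N, and let ν be the unique partition of N such that every part of ν has multiplicity at most p−1 and, for every positive integer k coprime to p, ∑_{j≥0} k·p^j · (multiplicity of k·p^j in ν) = ∑_{j≥0} k·p^j · (multiplicity of k·p^j in μ). Fix a positive integer k coprime to p and let ℓ be the nonnegative integer with k·ℓ = ∑_{j≥0} k·p^j · (multiplicity of k·p^j in μ). Then for every j ≥ 0, the multiplicity of k·p^j in ν equals the digit of p^j in the base-p expansion of ℓ. -/
/-- The base-`p` digits of `∑ i < n, p ^ i * a i` are the coefficients `a i`, provided that these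
are all less than `p` and vanish from index `n` on. -/
theorem sum_pow_mul_div_pow_mod {p : ℕ} (n : ℕ) (a : ℕ → ℕ) (ha : ∀ i, a i < p)
    (ha₀ : ∀ i, n ≤ i → a i = 0) (j : ℕ) :
    (∑ i ∈ Finset.range n, p ^ i * a i) / p ^ j % p = a j := by
  induction n generalizing a j with
  | zero => simp [ha₀ j]
  | succ n ih =>
    have hp : 0 < p := (Nat.zero_le _).trans_lt (ha 0)
    have hsum : ∑ i ∈ Finset.range (n + 1), p ^ i * a i =
        a 0 + p * ∑ i ∈ Finset.range n, p ^ i * a (i + 1) := by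
      rw [Finset.sum_range_succ', Finset.mul_sum, add_comm]
      simp [pow_succ', mul_assoc]
    rw [hsum]
    cases j with
    | zero => simp [Nat.mod_eq_of_lt (ha 0)]
    | succ j =>
      rw [pow_succ', ← Nat.div_div_eq_div_mul, Nat.add_mul_div_left _ _ hp,
        Nat.div_eq_of_lt (ha 0), zero_add]
      exact ih (fun i => a (i + 1)) (fun i => ha _) (fun i hi => ha₀ _ (by lia)) j

/-- A number larger than `N` is not a part of a partition of `N`. -/
theorem Nat.Partition.count_parts_eq_zero_of_lt {N m : ℕ} (ν : Nat.Partition N) (h : N < m) :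
    ν.parts.count m = 0 :=
  Multiset.count_eq_zero.2 fun hm =>
    h.not_ge ((Multiset.le_sum_of_mem hm).trans_eq ν.parts_sum)


/-- Let `p` be a prime, `μ` a partition of a positive integer `N`, and
`ν` the unique partition of `N` in which every part has multiplicity at most `p − 1` and,
for every positive `k` coprime to `p`, `∑_{j≥0} k·p^j·(mult of k·p^j in ν)` agrees with the
corresponding sum for `μ`.  If `k` is a positive integer coprime to `p` and `ℓ` satisfies
`k·ℓ = ∑_{j≥0} k·p^j·(mult of k·p^j in μ)`, then for every `j ≥ 0` the multiplicity of
`k·p^j` in `ν` equals the digit of `p^j` in the base-`p` expansion of `ℓ`, i.e.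
`⌊ℓ/p^j⌋ mod p`.  (Since all parts are at most `N`, the sum over `j ∈ {0, …, N}` captures
all nonzero terms of the sum over all `j ≥ 0`.) -/
theorem reduction_counts_are_base_p_digits (p : ℕ) (hp : p.Prime) (N : ℕ) (hN : 0 < N)
    (μ ν : Nat.Partition N)
    (hν₁ : ∀ m : ℕ, ν.parts.count m ≤ p - 1)
    (hν₂ : ∀ k : ℕ, 0 < k → Nat.Coprime k p →
      ∑ j ∈ Finset.range (N + 1), k * p ^ j * ν.parts.count (k * p ^ j) =
        ∑ j ∈ Finset.range (N + 1), k * p ^ j * μ.parts.count (k * p ^ j))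
    (k : ℕ) (hk : 0 < k) (hkp : Nat.Coprime k p) (ℓ : ℕ)
    (hℓ : k * ℓ = ∑ j ∈ Finset.range (N + 1), k * p ^ j * μ.parts.count (k * p ^ j)) :
    ∀ j : ℕ, ν.parts.count (k * p ^ j) = ℓ / p ^ j % p := by
  have hℓ' : ℓ = ∑ j ∈ Finset.range (N + 1), p ^ j * ν.parts.count (k * p ^ j) := by
    apply Nat.eq_of_mul_eq_mul_left hk
    rw [hℓ, ← hν₂ k hk hkp, Finset.mul_sum]
    simp only [mul_assoc]
  intro j
  rw [hℓ']
  refine (sum_pow_mul_div_pow_mod (N + 1) (fun i => ν.parts.count (k * p ^ i))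
    (fun i => (hν₁ _).trans_lt (Nat.sub_lt hp.pos one_pos)) (fun i hi => ?_) j).symm
  apply ν.count_parts_eq_zero_of_lt
  calc N < i := hi
    _ < p ^ i := Nat.lt_pow_self hp.one_lt
    _ ≤ k * p ^ i := Nat.le_mul_of_pos_left _ hk
end

section
/- Let p be a prime, N a positive integer, r a positive integer, 𝒦 a set of positive integers each coprime to p, and 0 < q < 1 a real number. Let p(N; 𝒦, p^r) denote the number of partitions μ of N such that for every k ∈ 𝒦, the sum of the parts of μ of the form k·p^j (over j ≥ 0, counted with multiplicity) equals k·ℓ for some nonnegative integer ℓ < p^r. Then p(N; 𝒦, p^r) ≤ q^(−N) · ∏_{n=1}^∞ (1 − q^n)^(−1) · ∏_{k ∈ 𝒦} [ (∑_{ℓ=0}^{p^r − 1} p̃(ℓ)·q^(k·ℓ)) / (∑_{ℓ=0}^∞ p̃(ℓ)·q^(k·ℓ)) ]. -/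
/-- `ptilde p j` is the number of partitions of `j` into parts that are powers of `p`
(including `p⁰ = 1`); in particular `ptilde p 0 = 1` (the empty partition). -/
noncomputable def ptilde (p j : ℕ) : ℕ :=
  Nat.card {π : Nat.Partition j // ∀ a ∈ π.parts, ∃ i : ℕ, a = p ^ i}

/-- Splitting each multiset of a finite family into the parts satisfying `P` and the others
bounds the generating function of the family by a product. -/
theorem sum_pow_sum_le_mul_filter {x : ℝ} (hx : 0 ≤ x) (G : Finset (Multiset ℕ)) (P : ℕ → Prop)
    [DecidablePred P] :
    ∑ μ ∈ G, x ^ μ.sum ≤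
      (∑ μ ∈ G.image (Multiset.filter fun a => ¬ P a), x ^ μ.sum) *
        ∑ μ ∈ G.image (Multiset.filter P), x ^ μ.sum := by
  rw [Finset.sum_mul_sum, ← Finset.sum_product']
  have hinj : Set.InjOn
      (fun μ : Multiset ℕ => (μ.filter (fun a => ¬ P a), μ.filter P)) G := by
    intro μ _ ν _ h
    simp only [Prod.mk.injEq] at h
    rw [← Multiset.filter_add_not P μ, ← Multiset.filter_add_not P ν, h.1, h.2]
  calc ∑ μ ∈ G, x ^ μ.sum
      = ∑ z ∈ G.image (fun μ : Multiset ℕ => (μ.filter (fun a => ¬ P a), μ.filter P)),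
          x ^ z.1.sum * x ^ z.2.sum := by
        rw [Finset.sum_image hinj]
        refine Finset.sum_congr rfl fun μ _ => ?_
        dsimp only
        rw [← pow_add, ← Multiset.sum_add, add_comm (Multiset.filter _ _), Multiset.filter_add_not]
    _ ≤ _ := by
        refine Finset.sum_le_sum_of_subset_of_nonneg ?_ fun _ _ _ => by positivity
        intro z hz
        obtain ⟨μ, hμ, rfl⟩ := Finset.mem_image.1 hz
        exact Finset.mem_product.2
          ⟨Finset.mem_image_of_mem _ hμ, Finset.mem_image_of_mem _ hμ⟩

theorem one_le_inv_one_sub_pow {x : ℝ} (hx0 : 0 ≤ x) (hx1 : x < 1) {n : ℕ} (hn : 0 < n) :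
    1 ≤ (1 - x ^ n)⁻¹ := by
  have h1 : x ^ n < 1 := pow_lt_one₀ hx0 hx1 hn.ne'
  have h0 : 0 ≤ x ^ n := by positivity
  exact (one_le_inv₀ (by linarith)).2 (by linarith)

theorem sum_pow_sum_le_of_forall_eq {x : ℝ} (hx0 : 0 ≤ x) (hx1 : x < 1) {n : ℕ} (hn : 0 < n)
    (G : Finset (Multiset ℕ)) (hG : ∀ μ ∈ G, ∀ a ∈ μ, a = n) :
    ∑ μ ∈ G, x ^ μ.sum ≤ (1 - x ^ n)⁻¹ := by
  have h1 : x ^ n < 1 := pow_lt_one₀ hx0 hx1 hn.ne'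
  have h0 : 0 ≤ x ^ n := by positivity
  have hrep : ∀ μ ∈ G, μ = Multiset.replicate (Multiset.card μ) n := fun μ hμ =>
    Multiset.eq_replicate.2 ⟨rfl, hG μ hμ⟩
  have hinj : Set.InjOn (Multiset.card : Multiset ℕ → ℕ) G := by
    intro μ hμ ν hν h
    rw [hrep μ hμ, hrep ν hν, h]
  rw [← tsum_geometric_of_lt_one h0 h1]
  calc ∑ μ ∈ G, x ^ μ.sum = ∑ m ∈ G.image Multiset.card, (x ^ n) ^ m := by
        rw [Finset.sum_image hinj]
        refine Finset.sum_congr rfl fun μ hμ => ?_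
        conv_lhs => rw [hrep μ hμ]
        rw [Multiset.sum_replicate, smul_eq_mul, mul_comm, pow_mul]
    _ ≤ _ := (summable_geometric_of_lt_one h0 h1).sum_le_tsum _ fun _ _ => by positivity

theorem sum_pow_sum_le_prod {x : ℝ} (hx0 : 0 ≤ x) (hx1 : x < 1) (A : Finset ℕ)
    (hA : ∀ n ∈ A, 0 < n) (G : Finset (Multiset ℕ)) (hG : ∀ μ ∈ G, ∀ a ∈ μ, a ∈ A) :
    ∑ μ ∈ G, x ^ μ.sum ≤ ∏ n ∈ A, (1 - x ^ n)⁻¹ := by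
  classical
  induction A using Finset.induction_on generalizing G with
  | empty =>
    have hsub : G ⊆ {0} := fun μ hμ => by
      rw [Finset.mem_singleton]
      exact Multiset.eq_zero_of_forall_notMem fun a ha => by simpa using hG μ hμ a ha
    refine (Finset.sum_le_sum_of_subset_of_nonneg hsub fun _ _ _ => by positivity).trans ?_
    simp
  | insert n A hn ih =>
    rw [Finset.prod_insert hn, mul_comm]
    refine (sum_pow_sum_le_mul_filter hx0 G (· = n)).trans ?_
    refine mul_le_mul (ih (fun m hm => hA m (Finset.mem_insert_of_mem hm)) _ ?_)
      (sum_pow_sum_le_of_forall_eq hx0 hx1 (hA n (Finset.mem_insert_self _ _)) _ ?_)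
      (Finset.sum_nonneg fun _ _ => by positivity)
      (Finset.prod_nonneg fun m hm => zero_le_one.trans
        (one_le_inv_one_sub_pow hx0 hx1 (hA m (Finset.mem_insert_of_mem hm))))
    · intro ν hν a ha
      obtain ⟨μ, hμ, rfl⟩ := Finset.mem_image.1 hν
      obtain ⟨ha1, ha2⟩ := Multiset.mem_filter.1 ha
      exact (Finset.mem_insert.1 (hG μ hμ a ha1)).resolve_left ha2
    · intro ν hν a ha
      obtain ⟨μ, hμ, rfl⟩ := Finset.mem_image.1 hν
      exact (Multiset.mem_filter.1 ha).2

theorem ptilde_eq_card (p j : ℕ)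
    [Fintype {π : Nat.Partition j // ∀ a ∈ π.parts, ∃ i : ℕ, a = p ^ i}] :
    ptilde p j = Fintype.card {π : Nat.Partition j // ∀ a ∈ π.parts, ∃ i : ℕ, a = p ^ i} :=
  Nat.card_eq_fintype_card

/-- A finite family of multisets with parts `k * p ^ j` and sum `k * ℓ` has at most `ptilde p ℓ`
members. -/
theorem card_le_ptilde {p k ℓ : ℕ} (hp : 0 < p) (hk : 0 < k) (G : Finset (Multiset ℕ))
    (hG : ∀ μ ∈ G, ∀ a ∈ μ, ∃ j, a = k * p ^ j) (hsum : ∀ μ ∈ G, μ.sum = k * ℓ) :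
    G.card ≤ ptilde p ℓ := by
  classical
  rw [ptilde_eq_card, ← Finset.card_univ]
  refine (Finset.card_le_card (t := Finset.univ.image
    (fun π : {π : Nat.Partition ℓ // ∀ a ∈ π.parts, ∃ i : ℕ, a = p ^ i} =>
      π.1.parts.map (k * ·))) fun μ hμ => ?_).trans Finset.card_image_le
  have hμk : (μ.map (· / k)).map (k * ·) = μ := by
    rw [Multiset.map_map]
    conv_rhs => rw [← Multiset.map_id μ]
    refine Multiset.map_congr rfl fun a ha => ?_
    obtain ⟨j, rfl⟩ := hG μ hμ a ha
    simp [Nat.mul_div_cancel_left _ hk]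
  have hpow : ∀ a ∈ μ.map (· / k), ∃ i, a = p ^ i := by
    intro a ha
    obtain ⟨b, hb, rfl⟩ := Multiset.mem_map.1 ha
    obtain ⟨j, rfl⟩ := hG μ hμ b hb
    exact ⟨j, Nat.mul_div_cancel_left _ hk⟩
  refine Finset.mem_image.2 ⟨⟨⟨μ.map (· / k), ?_, ?_⟩, hpow⟩, Finset.mem_univ _, hμk⟩
  · intro i hi
    obtain ⟨j, rfl⟩ := hpow i hi
    positivity
  · have h := hsum μ hμ
    rw [← hμk, Multiset.sum_map_mul_left, Multiset.map_id'] at h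
    exact Nat.eq_of_mul_eq_mul_left hk h

theorem sum_pow_sum_le_sum_ptilde {x : ℝ} (hx0 : 0 ≤ x) {p k M : ℕ} (hp : 0 < p) (hk : 0 < k)
    (G : Finset (Multiset ℕ)) (hG : ∀ μ ∈ G, ∀ a ∈ μ, ∃ j, a = k * p ^ j)
    (hsum : ∀ μ ∈ G, μ.sum < k * M) :
    ∑ μ ∈ G, x ^ μ.sum ≤ ∑ ℓ ∈ Finset.range M, (ptilde p ℓ : ℝ) * x ^ (k * ℓ) := by
  classical
  have hdvd : ∀ μ ∈ G, k ∣ μ.sum := fun μ hμ => Multiset.dvd_sum fun a ha => by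
    obtain ⟨j, rfl⟩ := hG μ hμ a ha
    exact Dvd.intro _ rfl
  rw [← Finset.sum_fiberwise_of_maps_to (t := Finset.range M) (g := fun μ => μ.sum / k)
    fun μ hμ => Finset.mem_range.2 (Nat.div_lt_of_lt_mul (hsum μ hμ))]
  refine Finset.sum_le_sum fun ℓ _ => ?_
  have hs : ∀ μ ∈ G.filter (fun μ => μ.sum / k = ℓ), μ.sum = k * ℓ := by
    intro μ hμ
    obtain ⟨hμG, rfl⟩ := Finset.mem_filter.1 hμ
    exact (Nat.mul_div_cancel' (hdvd μ hμG)).symm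
  rw [Finset.sum_congr rfl fun μ hμ => by rw [hs μ hμ], Finset.sum_const, nsmul_eq_mul]
  gcongr
  exact card_le_ptilde hp hk _ (fun μ hμ => hG μ (Finset.mem_filter.1 hμ).1) hs

theorem sum_ptilde_le_prod {x : ℝ} (hx0 : 0 ≤ x) (hx1 : x < 1) {p : ℕ} (hp : 1 < p) (L : ℕ) :
    ∑ ℓ ∈ Finset.range L, (ptilde p ℓ : ℝ) * x ^ ℓ ≤
      ∏ j ∈ Finset.range L, (1 - x ^ p ^ j)⁻¹ := by
  classical
  let Q : ℕ → Finset (Multiset ℕ) := fun ℓ => Finset.univ.image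
    (fun π : {π : Nat.Partition ℓ // ∀ a ∈ π.parts, ∃ i : ℕ, a = p ^ i} => π.1.parts)
  have hQsum : ∀ ℓ, ∀ μ ∈ Q ℓ, μ.sum = ℓ := by
    intro ℓ μ hμ
    obtain ⟨π, _, rfl⟩ := Finset.mem_image.1 hμ
    exact π.1.parts_sum
  have hQcard : ∀ ℓ, (Q ℓ).card = ptilde p ℓ := by
    intro ℓ
    rw [ptilde_eq_card, ← Finset.card_univ]
    refine Finset.card_image_of_injective _ fun π ρ h => ?_
    exact Subtype.ext (Nat.Partition.ext h)
  have hdisj : ((Finset.range L : Finset ℕ) : Set ℕ).PairwiseDisjoint Q := by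
    intro a _ b _ hab
    refine Finset.disjoint_left.2 fun μ ha hb => hab ?_
    rw [← hQsum a μ ha, hQsum b μ hb]
  have heq : ∑ ℓ ∈ Finset.range L, (ptilde p ℓ : ℝ) * x ^ ℓ =
      ∑ μ ∈ (Finset.range L).biUnion Q, x ^ μ.sum := by
    rw [Finset.sum_biUnion hdisj]
    refine Finset.sum_congr rfl fun ℓ _ => ?_
    rw [Finset.sum_congr rfl fun μ hμ => by rw [hQsum ℓ μ hμ], Finset.sum_const, nsmul_eq_mul,
      hQcard]
  rw [heq, ← Finset.prod_image (s := Finset.range L) (g := fun j => p ^ j)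
    (f := fun n => (1 - x ^ n)⁻¹) (Nat.pow_right_injective hp).injOn]
  refine sum_pow_sum_le_prod hx0 hx1 _ ?_ _ ?_
  · intro n hn
    obtain ⟨j, _, rfl⟩ := Finset.mem_image.1 hn
    positivity
  · intro μ hμ a ha
    obtain ⟨ℓ, hℓ, hμ⟩ := Finset.mem_biUnion.1 hμ
    have hle : a ≤ ℓ := hQsum ℓ μ hμ ▸ Multiset.le_sum_of_mem ha
    obtain ⟨π, _, rfl⟩ := Finset.mem_image.1 hμ
    obtain ⟨i, rfl⟩ := π.2 a ha
    exact Finset.mem_image_of_mem _ (Finset.mem_range.2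
      ((Nat.lt_pow_self hp).trans_le (hle.trans (Finset.mem_range.1 hℓ).le)))

theorem eq_and_eq_of_mul_prime_pow_eq {p k k' i j : ℕ} (hp : p.Prime) (hk : 0 < k)
    (hkp : k.Coprime p) (hkp' : k'.Coprime p) (h : k * p ^ i = k' * p ^ j) : k = k' ∧ i = j := by
  have hkk : k = k' := Nat.dvd_antisymm
    ((hkp.pow_right j).dvd_of_dvd_mul_right (h ▸ Dvd.intro _ rfl))
    ((hkp'.pow_right i).dvd_of_dvd_mul_right (h ▸ Dvd.intro _ rfl))
  subst hkk
  exact ⟨rfl, Nat.pow_right_injective hp.two_le (Nat.eq_of_mul_eq_mul_left hk h)⟩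

open scoped Classical in
theorem sum_pow_sum_le_prod_mul_prod {x : ℝ} (hx0 : 0 ≤ x) (hx1 : x < 1) {p M : ℕ}
    (hp : p.Prime) (A : Finset ℕ) (hA : ∀ n ∈ A, 0 < n) (S : Finset ℕ)
    (hS : ∀ k ∈ S, 0 < k ∧ k.Coprime p) (G : Finset (Multiset ℕ))
    (hG : ∀ μ ∈ G, ∀ a ∈ μ, a ∈ A ∨ ∃ k ∈ S, ∃ j, a = k * p ^ j)
    (hsum : ∀ μ ∈ G, ∀ k ∈ S, (μ.filter fun a => ∃ j, a = k * p ^ j).sum < k * M) :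
    ∑ μ ∈ G, x ^ μ.sum ≤ (∏ n ∈ A, (1 - x ^ n)⁻¹) *
      ∏ k ∈ S, ∑ ℓ ∈ Finset.range M, (ptilde p ℓ : ℝ) * x ^ (k * ℓ) := by
  induction S using Finset.induction_on generalizing G with
  | empty => simpa using sum_pow_sum_le_prod hx0 hx1 A hA G (by simpa using hG)
  | insert k S hkS ih =>
    rw [Finset.prod_insert hkS, mul_left_comm, mul_comm]
    have hk := hS k (Finset.mem_insert_self _ _)
    refine (sum_pow_sum_le_mul_filter hx0 G (fun a => ∃ j, a = k * p ^ j)).trans ?_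
    refine mul_le_mul (ih (fun m hm => hS m (Finset.mem_insert_of_mem hm)) _ ?_ ?_)
      (sum_pow_sum_le_sum_ptilde hx0 hp.pos hk.1 _ ?_ ?_)
      (Finset.sum_nonneg fun _ _ => by positivity)
      (mul_nonneg (Finset.prod_nonneg fun m hm => zero_le_one.trans
        (one_le_inv_one_sub_pow hx0 hx1 (hA m hm)))
        (Finset.prod_nonneg fun _ _ => Finset.sum_nonneg fun _ _ => by positivity))
    · intro ν hν a ha
      obtain ⟨μ, hμ, rfl⟩ := Finset.mem_image.1 hν
      obtain ⟨ha1, ha2⟩ := Multiset.mem_filter.1 ha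
      refine (hG μ hμ a ha1).imp_right ?_
      rintro ⟨k', hk', hj⟩
      refine ⟨k', (Finset.mem_insert.1 hk').resolve_left ?_, hj⟩
      rintro rfl
      exact ha2 hj
    · intro ν hν k' hk'
      obtain ⟨μ, hμ, rfl⟩ := Finset.mem_image.1 hν
      refine lt_of_eq_of_lt ?_ (hsum μ hμ k' (Finset.mem_insert_of_mem hk'))
      rw [Multiset.filter_filter]
      congr 1
      refine Multiset.filter_congr fun a _ => and_iff_left_of_imp ?_
      rintro ⟨j, rfl⟩ ⟨i, hi⟩
      have hk'S := hS k' (Finset.mem_insert_of_mem hk')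
      exact hkS ((eq_and_eq_of_mul_prime_pow_eq hp hk'S.1 hk'S.2 hk.2 hi).1 ▸ hk')
    · intro ν hν a ha
      obtain ⟨μ, hμ, rfl⟩ := Finset.mem_image.1 hν
      exact (Multiset.mem_filter.1 ha).2
    · intro ν hν
      obtain ⟨μ, hμ, rfl⟩ := Finset.mem_image.1 hν
      exact hsum μ hμ k (Finset.mem_insert_self _ _)

theorem multipliable_inv_one_sub_pow {x : ℝ} (hx0 : 0 ≤ x) (hx1 : x < 1) :
    Multipliable fun n : ℕ => (1 - x ^ (n + 1))⁻¹ := by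
  have h : Summable fun n : ℕ => (1 - x ^ (n + 1))⁻¹ - 1 := by
    refine Summable.of_nonneg_of_le
      (fun n => sub_nonneg.2 (one_le_inv_one_sub_pow hx0 hx1 n.succ_pos)) (fun n => ?_)
      ((summable_geometric_of_lt_one hx0 hx1).mul_left (1 - x)⁻¹)
    have h1 : x ^ (n + 1) ≤ x := pow_le_of_le_one hx0 hx1.le n.succ_ne_zero
    have h2 : (1 - x ^ (n + 1))⁻¹ - 1 = (1 - x ^ (n + 1))⁻¹ * x ^ (n + 1) := by
      have : 1 - x ^ (n + 1) ≠ 0 := by linarith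
      field_simp
      ring
    rw [h2]
    have h3 : x ^ (n + 1) ≤ x ^ n := pow_le_pow_of_le_one hx0 hx1.le n.le_succ
    have h4 : 0 < 1 - x := by linarith
    gcongr
  simpa using Real.multipliable_one_add_of_summable h

theorem prod_inv_one_sub_pow_le_tprod {x : ℝ} (hx0 : 0 ≤ x) (hx1 : x < 1) (U : Finset ℕ)
    (hU : ∀ n ∈ U, 0 < n) :
    ∏ n ∈ U, (1 - x ^ n)⁻¹ ≤ ∏' n : ℕ, (1 - x ^ (n + 1))⁻¹ := by
  classical
  have hone : ∀ n : ℕ, 1 ≤ (1 - x ^ (n + 1))⁻¹ := fun n =>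
    one_le_inv_one_sub_pow hx0 hx1 n.succ_pos
  have hU' : ∏ n ∈ U, (1 - x ^ n)⁻¹ = ∏ n ∈ U.image (· - 1), (1 - x ^ (n + 1))⁻¹ := by
    rw [Finset.prod_image]
    · refine Finset.prod_congr rfl fun n hn => ?_
      rw [Nat.sub_add_cancel (hU n hn)]
    · intro a ha b hb h
      have := hU a ha
      have := hU b hb
      dsimp only at h
      omega
  rw [hU']
  refine ge_of_tendsto (multipliable_inv_one_sub_pow hx0 hx1).hasProd ?_
  filter_upwards [Filter.eventually_ge_atTop (U.image (· - 1))] with T hT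
  exact Finset.prod_le_prod_of_subset_of_one_le hT (fun n _ => zero_le_one.trans (hone n))
    fun n _ _ => hone n

theorem summable_ptilde {x : ℝ} (hx0 : 0 ≤ x) (hx1 : x < 1) {p : ℕ} (hp : 1 < p) :
    Summable fun ℓ : ℕ => (ptilde p ℓ : ℝ) * x ^ ℓ := by
  classical
  refine summable_of_sum_range_le (c := ∏' n : ℕ, (1 - x ^ (n + 1))⁻¹)
    (fun _ => by positivity) fun L => (sum_ptilde_le_prod hx0 hx1 hp L).trans ?_
  rw [← Finset.prod_image (s := Finset.range L) (g := fun j => p ^ j)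
    (f := fun n => (1 - x ^ n)⁻¹) (Nat.pow_right_injective hp).injOn]
  refine prod_inv_one_sub_pow_le_tprod hx0 hx1 _ fun n hn => ?_
  obtain ⟨j, _, rfl⟩ := Finset.mem_image.1 hn
  positivity

theorem summable_ptilde_mul {x : ℝ} (hx0 : 0 ≤ x) (hx1 : x < 1) {p k : ℕ} (hp : 1 < p)
    (hk : 0 < k) : Summable fun ℓ : ℕ => (ptilde p ℓ : ℝ) * x ^ (k * ℓ) := by
  simpa only [pow_mul] using
    summable_ptilde (pow_nonneg hx0 k) (pow_lt_one₀ hx0 hx1 hk.ne') hp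

theorem prod_mul_prod_tsum_ptilde_le_tprod {x : ℝ} (hx0 : 0 ≤ x) (hx1 : x < 1) {p : ℕ}
    (hp : p.Prime) (A : Finset ℕ) (hA : ∀ n ∈ A, 0 < n) (S : Finset ℕ)
    (hS : ∀ k ∈ S, 0 < k ∧ k.Coprime p) (hAS : ∀ k ∈ S, ∀ j, k * p ^ j ∉ A) :
    (∏ n ∈ A, (1 - x ^ n)⁻¹) * ∏ k ∈ S, ∑' ℓ : ℕ, (ptilde p ℓ : ℝ) * x ^ (k * ℓ) ≤
      ∏' n : ℕ, (1 - x ^ (n + 1))⁻¹ := by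
  classical
  have hA0 : 0 ≤ ∏ n ∈ A, (1 - x ^ n)⁻¹ := Finset.prod_nonneg fun n hn =>
    zero_le_one.trans (one_le_inv_one_sub_pow hx0 hx1 (hA n hn))
  have hlim := (tendsto_finsetProd S fun k hk =>
    (summable_ptilde_mul hx0 hx1 hp.one_lt (hS k hk).1).hasSum.tendsto_sum_nat).const_mul
      (∏ n ∈ A, (1 - x ^ n)⁻¹)
  refine le_of_tendsto' hlim fun L => ?_
  let B : ℕ → Finset ℕ := fun k => (Finset.range L).image fun j => k * p ^ j
  have hB : ∀ k, ∀ n ∈ B k, ∃ j, n = k * p ^ j := by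
    intro k n hn
    obtain ⟨j, _, rfl⟩ := Finset.mem_image.1 hn
    exact ⟨j, rfl⟩
  have hdisj : (S : Set ℕ).PairwiseDisjoint B := by
    intro k hk k' hk' hne
    refine Finset.disjoint_left.2 fun n hn hn' => hne ?_
    obtain ⟨i, rfl⟩ := hB k n hn
    obtain ⟨j, hj⟩ := hB k' _ hn'
    exact (eq_and_eq_of_mul_prime_pow_eq hp (hS k hk).1 (hS k hk).2 (hS k' hk').2 hj).1
  have hdisjA : Disjoint A (S.biUnion B) := by
    refine Finset.disjoint_left.2 fun n hn hn' => ?_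
    obtain ⟨k, hk, hn'⟩ := Finset.mem_biUnion.1 hn'
    obtain ⟨j, rfl⟩ := hB k n hn'
    exact hAS k hk j hn
  calc _ ≤ (∏ n ∈ A, (1 - x ^ n)⁻¹) * ∏ k ∈ S, ∏ n ∈ B k, (1 - x ^ n)⁻¹ := by
        refine mul_le_mul_of_nonneg_left (Finset.prod_le_prod
          (fun _ _ => Finset.sum_nonneg fun _ _ => by positivity) fun k hk => ?_) hA0
        rw [Finset.prod_image fun i _ j _ h =>
          (eq_and_eq_of_mul_prime_pow_eq hp (hS k hk).1 (hS k hk).2 (hS k hk).2 h).2]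
        simpa only [pow_mul] using sum_ptilde_le_prod (pow_nonneg hx0 k)
          (pow_lt_one₀ hx0 hx1 (hS k hk).1.ne') hp.one_lt L
    _ = ∏ n ∈ A ∪ S.biUnion B, (1 - x ^ n)⁻¹ := by
        rw [Finset.prod_union hdisjA, Finset.prod_biUnion hdisj]
    _ ≤ _ := by
        refine prod_inv_one_sub_pow_le_tprod hx0 hx1 _ fun n hn => ?_
        rcases Finset.mem_union.1 hn with hn | hn
        · exact hA n hn
        · obtain ⟨k, hk, hn⟩ := Finset.mem_biUnion.1 hn
          obtain ⟨j, rfl⟩ := hB k n hn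
          exact Nat.mul_pos (hS k hk).1 (pow_pos hp.pos j)

open scoped Classical in
theorem sum_filter_mul_pow_eq {p k N : ℕ} (hp : p.Prime) (hk : 0 < k) (m : Multiset ℕ)
    (hm : m.sum = N) :
    (m.filter fun a => ∃ j, a = k * p ^ j).sum =
      ∑ j ∈ Finset.range (N + 1), k * p ^ j * m.count (k * p ^ j) := by
  have hinj : Function.Injective fun j => k * p ^ j := fun i j h =>
    Nat.pow_right_injective hp.two_le (Nat.eq_of_mul_eq_mul_left hk h)
  rw [Finset.sum_multiset_count_of_subset _ ((Finset.range (N + 1)).image fun j => k * p ^ j),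
    Finset.sum_image hinj.injOn]
  · refine Finset.sum_congr rfl fun j _ => ?_
    rw [Multiset.count_filter_of_pos ⟨j, rfl⟩, smul_eq_mul, mul_comm]
  · intro a ha
    obtain ⟨ha, j, rfl⟩ := Multiset.mem_filter.1 (Multiset.mem_toFinset.1 ha)
    refine Finset.mem_image_of_mem _ (Finset.mem_range.2 ?_)
    have h1 : k * p ^ j ≤ N := hm ▸ Multiset.le_sum_of_mem ha
    have h2 : j < p ^ j := Nat.lt_pow_self hp.one_lt
    have h3 : p ^ j ≤ k * p ^ j := Nat.le_mul_of_pos_left _ hk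
    omega

theorem hasProd_iInf_of_le_one {ι : Type*} {f : ι → ℝ} (hf0 : ∀ i, 0 ≤ f i)
    (hf1 : ∀ i, f i ≤ 1) : HasProd f (⨅ S : Finset ι, ∏ i ∈ S, f i) :=
  tendsto_atTop_ciInf (Finset.prod_anti_set_of_le_one hf0 hf1)
    ⟨0, by rintro _ ⟨S, rfl⟩; exact Finset.prod_nonneg fun i _ => hf0 i⟩


/-- Let `p` be a prime, `N, r` positive integers, `𝒦` a set of positive
integers coprime to `p`, and `0 < q < 1`.  The number of partitions `μ` of `N` such that,
for every `k ∈ 𝒦`, the sum of the parts of `μ` of the form `k·p^j` equals `k·ℓ` for some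
`ℓ < p^r`, is at most
`q^(−N) · ∏_{n≥1} (1 − q^n)⁻¹ · ∏_{k ∈ 𝒦} (∑_{ℓ < p^r} p̃(ℓ)·q^(kℓ)) / (∑_{ℓ≥0} p̃(ℓ)·q^(kℓ))`.
(Since all parts are at most `N`, the sum over `j ∈ {0, …, N}` captures all nonzero terms
of the sum over all `j ≥ 0`.) -/
theorem restricted_partition_count_bound (p : ℕ) (hp : p.Prime) (N : ℕ) (hN : 0 < N)
    (r : ℕ) (hr : 0 < r) (𝒦 : Set ℕ) (h𝒦 : ∀ k ∈ 𝒦, 0 < k ∧ Nat.Coprime k p)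
    (q : ℝ) (hq0 : 0 < q) (hq1 : q < 1) :
    (Set.ncard {μ : Nat.Partition N | ∀ k ∈ 𝒦, ∃ ℓ : ℕ, ℓ < p ^ r ∧
        ∑ j ∈ Finset.range (N + 1), k * p ^ j * μ.parts.count (k * p ^ j) = k * ℓ} : ℝ) ≤
      q ^ (-(N : ℤ)) * (∏' n : ℕ, (1 - q ^ (n + 1))⁻¹) *
        ∏' k : 𝒦, (∑ ℓ ∈ Finset.range (p ^ r), (ptilde p ℓ : ℝ) * q ^ ((k : ℕ) * ℓ)) /
          (∑' ℓ : ℕ, (ptilde p ℓ : ℝ) * q ^ ((k : ℕ) * ℓ)) := by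
  classical
  have hq0' := hq0.le
  let T : ℕ → ℝ := fun k => ∑ ℓ ∈ Finset.range (p ^ r), (ptilde p ℓ : ℝ) * q ^ (k * ℓ)
  let F : ℕ → ℝ := fun k => ∑' ℓ : ℕ, (ptilde p ℓ : ℝ) * q ^ (k * ℓ)
  have hT0 : ∀ k, 0 ≤ T k := fun k => Finset.sum_nonneg fun _ _ => by positivity
  have hTF : ∀ k ∈ 𝒦, T k ≤ F k := fun k hk =>
    (summable_ptilde_mul hq0' hq1 hp.one_lt (h𝒦 k hk).1).sum_le_tsum _ fun _ _ => by positivity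
  have hF0 : ∀ k, 0 ≤ F k := fun k => tsum_nonneg fun _ => by positivity
  have hF : ∀ k ∈ 𝒦, T k / F k * F k = T k := fun k hk =>
    div_mul_cancel_of_imp fun h => le_antisymm (h ▸ hTF k hk) (hT0 k)
  set X : Set (Nat.Partition N) := {μ : Nat.Partition N | ∀ k ∈ 𝒦, ∃ ℓ : ℕ, ℓ < p ^ r ∧
        ∑ j ∈ Finset.range (N + 1), k * p ^ j * μ.parts.count (k * p ^ j) = k * ℓ}
  have key : ∀ S : Finset 𝒦, (X.ncard : ℝ) ≤
      q ^ (-(N : ℤ)) * (∏' n : ℕ, (1 - q ^ (n + 1))⁻¹) * ∏ k ∈ S, T k / F k := by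
    intro S'
    let S : Finset ℕ := S'.map (Function.Embedding.subtype _)
    have hS : ∀ k ∈ S, k ∈ 𝒦 := by
      intro k hk
      obtain ⟨k', _, rfl⟩ := Finset.mem_map.1 hk
      exact k'.2
    have hS' : ∏ k ∈ S', T k / F k = ∏ k ∈ S, T k / F k := by
      rw [Finset.prod_map]
      rfl
    rw [hS']
    let A : Finset ℕ := (Finset.Icc 1 N).filter fun n => ¬ ∃ k ∈ S, ∃ j, n = k * p ^ j
    have hA : ∀ n ∈ A, 0 < n := fun n hn =>
      (Finset.mem_Icc.1 (Finset.mem_filter.1 hn).1).1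
    let G : Finset (Multiset ℕ) := X.toFinset.image Nat.Partition.parts
    have hGX : ∀ m ∈ G, ∃ μ ∈ X, μ.parts = m := fun m hm => by
      obtain ⟨μ, hμ, rfl⟩ := Finset.mem_image.1 hm
      exact ⟨μ, Set.mem_toFinset.1 hμ, rfl⟩
    have hcount : (X.ncard : ℝ) * q ^ N = ∑ m ∈ G, q ^ m.sum := by
      rw [Finset.sum_image fun μ _ ν _ h => Nat.Partition.ext h,
        Finset.sum_congr rfl fun μ _ => by rw [μ.parts_sum], Finset.sum_const, nsmul_eq_mul,
        Set.ncard_eq_toFinset_card']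
    have hle : (X.ncard : ℝ) * q ^ N ≤ (∏ n ∈ A, (1 - q ^ n)⁻¹) * ∏ k ∈ S, T k := by
      rw [hcount]
      refine sum_pow_sum_le_prod_mul_prod hq0' hq1 hp A hA S (fun k hk => h𝒦 k (hS k hk)) G ?_ ?_
      · intro m hm a ha
        obtain ⟨μ, -, rfl⟩ := hGX m hm
        refine or_iff_not_imp_right.2 fun h => Finset.mem_filter.2 ⟨Finset.mem_Icc.2
          ⟨μ.parts_pos ha, ?_⟩, h⟩
        calc a ≤ μ.parts.sum := Multiset.le_sum_of_mem ha
          _ = N := μ.parts_sum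
      · intro m hm k hk
        obtain ⟨μ, hμ, rfl⟩ := hGX m hm
        obtain ⟨ℓ, hℓ, h⟩ := hμ k (hS k hk)
        rw [sum_filter_mul_pow_eq hp (h𝒦 k (hS k hk)).1 _ μ.parts_sum, h]
        exact Nat.mul_lt_mul_of_pos_left hℓ (h𝒦 k (hS k hk)).1
    have hAF := prod_mul_prod_tsum_ptilde_le_tprod hq0' hq1 hp A hA S
      (fun k hk => h𝒦 k (hS k hk)) fun k hk j h => (Finset.mem_filter.1 h).2 ⟨k, hk, j, rfl⟩
    have hfac : ∏ k ∈ S, T k = (∏ k ∈ S, F k) * ∏ k ∈ S, T k / F k := by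
      rw [← Finset.prod_mul_distrib]
      exact Finset.prod_congr rfl fun k hk => by rw [mul_comm, hF k (hS k hk)]
    rw [hfac, ← mul_assoc] at hle
    have hfin := hle.trans (mul_le_mul_of_nonneg_right hAF
      (Finset.prod_nonneg fun k _ => div_nonneg (hT0 k) (hF0 k)))
    rw [zpow_neg, zpow_natCast, mul_assoc, ← div_eq_inv_mul, le_div_iff₀ (pow_pos hq0 N)]
    exact hfin
  have hprod : HasProd (fun k : 𝒦 => T k / F k) _ :=
    hasProd_iInf_of_le_one (fun k => div_nonneg (hT0 k) (hF0 k))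
      fun k => div_le_one_of_le₀ (hTF k k.2) (hF0 k)
  exact ge_of_tendsto' (hprod.multipliable.hasProd.const_mul _) key
end

section
/- There exist an absolute constant c > 0 and an absolute constant N₀ such that the following holds for all N ≥ N₀ and every prime p with p ≤ (log N)/(log log N)². Set r = ⌊(log N)/(2·e·p)⌋, x = √(6N)/π, and K = (√(6N)/(2π·p^r))·(log N)·(1 + 1/(5p)). Then Δ := ∑_{k ≥ K, gcd(k,p)=1} ∑_{ℓ ≥ p^r} p̃(ℓ)·e^(−ℓ·k/x) / F_p(x/k) ≥ c · N^(1/(12p)), where the outer sum is over positive integers k ≥ K coprime to p. -/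
/-- `Fp p x = ∑_{j≥0} p̃(j)·e^(−j/x)`. -/
noncomputable def Fp (p : ℕ) (x : ℝ) : ℝ :=
  ∑' j : ℕ, (ptilde p j : ℝ) * Real.exp (-(j : ℝ) / x)

theorem ptilde_eq_sum {p : ℕ} (hp : 2 ≤ p) (y : ℕ) :
    ptilde p y = ∑ m ∈ Finset.range (y / p + 1), ptilde p m := by
  have hp0 : 0 < p := by omega
  have hmul : ∀ m : Fin (y / p + 1), p * (m : ℕ) ≤ y := fun m =>
    (Nat.mul_le_mul_left p (Nat.lt_succ_iff.mp m.2)).trans (Nat.mul_div_le y p)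
  let f : (Σ m : Fin (y / p + 1),
      {π : Nat.Partition (m : ℕ) // ∀ a ∈ π.parts, ∃ i : ℕ, a = p ^ i}) →
      {π : Nat.Partition y // ∀ a ∈ π.parts, ∃ i : ℕ, a = p ^ i} := fun z =>
    ⟨{ parts := Multiset.replicate (y - p * z.1) 1 + z.2.1.parts.map (p * ·)
       parts_pos := by
        intro i hi
        rcases Multiset.mem_add.mp hi with h | h
        · rw [Multiset.eq_of_mem_replicate h]; exact one_pos
        · obtain ⟨a, ha, rfl⟩ := Multiset.mem_map.mp h
          exact Nat.mul_pos hp0 (z.2.1.parts_pos ha)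
       parts_sum := by
        have h := hmul z.1
        rw [Multiset.sum_add, Multiset.sum_replicate, Multiset.sum_map_mul_left,
          Multiset.map_id', z.2.1.parts_sum]
        simp only [smul_eq_mul, mul_one]
        omega }, by
      intro a ha
      rcases Multiset.mem_add.mp ha with h | h
      · exact ⟨0, by rw [Multiset.eq_of_mem_replicate h, pow_zero]⟩
      · obtain ⟨b, hb, rfl⟩ := Multiset.mem_map.mp h
        obtain ⟨i, rfl⟩ := z.2.2 b hb
        exact ⟨i + 1, by rw [pow_succ']⟩⟩
  have hfilter : ∀ z, (f z).1.parts.filter (p ∣ ·) = z.2.1.parts.map (p * ·) := by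
    intro z
    change (Multiset.replicate (y - p * z.1) 1 + z.2.1.parts.map (p * ·)).filter (p ∣ ·) = _
    rw [Multiset.filter_add, Multiset.filter_eq_nil.mpr, Multiset.filter_eq_self.mpr, zero_add]
    · intro a ha
      obtain ⟨b, -, rfl⟩ := Multiset.mem_map.mp ha
      exact dvd_mul_right _ _
    · intro a ha h
      rw [Multiset.eq_of_mem_replicate ha, Nat.dvd_one] at h
      omega
  have hinj : Function.Injective f := by
    rintro ⟨m, π⟩ ⟨m', π'⟩ h
    have h1 : π.1.parts = π'.1.parts := by
      have := (hfilter ⟨m, π⟩).symm.trans ((by rw [h] : _ = _).trans (hfilter ⟨m', π'⟩))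
      exact Multiset.map_injective (fun a b hab => Nat.eq_of_mul_eq_mul_left hp0 hab) this
    have h2 : m = m' := Fin.ext (by rw [← π.1.parts_sum, ← π'.1.parts_sum, h1])
    subst h2
    congr 1
    exact Subtype.ext (Nat.Partition.ext h1)
  have hsurj : Function.Surjective f := by
    rintro ⟨π, hπ⟩
    set A := π.parts.filter (p ∣ ·) with hA
    set D := A.map (· / p) with hD
    have hAD : D.map (p * ·) = A := by
      rw [hD, Multiset.map_map]
      conv_rhs => rw [← Multiset.map_id A]
      refine Multiset.map_congr rfl fun a ha => ?_
      exact Nat.mul_div_cancel' (Multiset.mem_filter.mp ha).2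
    have hN : ∃ n, π.parts.filter (fun a => ¬ p ∣ a) = Multiset.replicate n 1 := by
      refine ⟨_, Multiset.eq_replicate_card.mpr fun a ha => ?_⟩
      obtain ⟨h1, h2⟩ := Multiset.mem_filter.mp ha
      obtain ⟨i, rfl⟩ := hπ a h1
      rcases i with _ | i
      · rfl
      · exact absurd (dvd_pow_self p (Nat.succ_ne_zero i)) h2
    obtain ⟨n, hn⟩ := hN
    have hparts : A + Multiset.replicate n 1 = π.parts := by
      rw [← hn]; exact Multiset.filter_add_not _ _
    have hsum : p * D.sum + n = y := by
      rw [← π.parts_sum, ← hparts, Multiset.sum_add, ← hAD, Multiset.sum_map_mul_left,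
        Multiset.map_id', Multiset.sum_replicate, smul_eq_mul, mul_one]
    have hDy : D.sum < y / p + 1 :=
      Nat.lt_succ_of_le ((Nat.le_div_iff_mul_le hp0).mpr (by rw [mul_comm]; omega))
    refine ⟨⟨⟨D.sum, hDy⟩, ⟨⟨D, ?_, rfl⟩, ?_⟩⟩, ?_⟩
    · intro a ha
      obtain ⟨b, hb, rfl⟩ := Multiset.mem_map.mp ha
      obtain ⟨h1, h2⟩ := Multiset.mem_filter.mp hb
      exact Nat.div_pos (Nat.le_of_dvd (π.parts_pos h1) h2) hp0
    · intro a ha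
      obtain ⟨b, hb, rfl⟩ := Multiset.mem_map.mp ha
      obtain ⟨h1, h2⟩ := Multiset.mem_filter.mp hb
      obtain ⟨i, rfl⟩ := hπ b h1
      rcases i with _ | i
      · rw [pow_zero, Nat.dvd_one] at h2
        omega
      · exact ⟨i, by rw [pow_succ, Nat.mul_div_cancel _ hp0]⟩
    · apply Subtype.ext
      apply Nat.Partition.ext
      change Multiset.replicate (y - p * D.sum) 1 + D.map (p * ·) = π.parts
      rw [hAD, ← hparts, add_comm, show y - p * D.sum = n by omega]
  rw [ptilde, ← Nat.card_congr (Equiv.ofBijective f ⟨hinj, hsurj⟩), Nat.card_sigma,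
    Finset.sum_range]
  rfl

theorem ptilde_zero (p : ℕ) : ptilde p 0 = 1 := by
  rw [ptilde, Nat.card_eq_one_iff_unique]
  refine ⟨inferInstance, ⟨⟨default, fun a ha => ?_⟩⟩⟩
  have h1 := Multiset.le_sum_of_mem ha
  rw [Nat.Partition.parts_sum] at h1
  have h2 := Nat.Partition.parts_pos _ ha
  omega

theorem ptilde_mono {p : ℕ} (hp : 2 ≤ p) : Monotone (ptilde p) := by
  intro a b hab
  rw [ptilde_eq_sum hp a, ptilde_eq_sum hp b]
  exact Finset.sum_le_sum_of_subset
    (Finset.range_mono (Nat.succ_le_succ (Nat.div_le_div_right hab)))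

theorem add_one_pow_succ_le_sum (n M : ℕ) :
    ((M : ℝ) + 1) ^ (n + 1) ≤ (n + 1) * ∑ m ∈ Finset.range (M + 1), ((m : ℝ) + 1) ^ n := by
  have key : ∀ m : ℕ, ((m : ℝ) + 1) ^ (n + 1) ≤ (m : ℝ) ^ (n + 1) + (n + 1) * ((m : ℝ) + 1) ^ n := by
    intro m
    have h := one_add_mul_le_pow (R := ℝ) (a := -1 / (m + 1)) (by
      rw [le_div_iff₀ (by positivity)]; linarith [(Nat.cast_nonneg m : (0 : ℝ) ≤ m)]) (n + 1)
    have hm : (0 : ℝ) < (m : ℝ) + 1 := by positivity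
    have h2 : (1 + -1 / ((m : ℝ) + 1)) = m / (m + 1) := by field_simp; ring
    rw [h2, div_pow, le_div_iff₀ (by positivity), pow_succ] at h
    have h3 : (1 + ((n + 1 : ℕ) : ℝ) * (-1 / ((m : ℝ) + 1))) * (((m : ℝ) + 1) ^ n * (m + 1)) =
        ((m : ℝ) + 1) ^ n * (m + 1) - (n + 1) * ((m : ℝ) + 1) ^ n := by
      push_cast; field_simp; ring
    rw [h3] at h
    rw [pow_succ]
    linarith
  induction M with
  | zero =>
    have := key 0
    simp at this ⊢
  | succ M ih =>
    rw [Finset.sum_range_succ, mul_add]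
    have := key (M + 1)
    push_cast at this ⊢
    linarith

theorem pow_div_le_ptilde {p : ℕ} (hp : 2 ≤ p) (n : ℕ) : ∀ y : ℕ,
    ((y : ℝ) + 1) ^ n / (n.factorial * ∏ i ∈ Finset.range n, (p : ℝ) ^ (i + 1)) ≤ ptilde p y := by
  have hp0 : (0 : ℝ) < p := by exact_mod_cast (by omega : 0 < p)
  induction n with
  | zero =>
    intro y
    have := ptilde_mono hp (Nat.zero_le y)
    rw [ptilde_zero] at this
    simpa using this
  | succ n ih =>
    intro y
    rw [ptilde_eq_sum hp y]
    push_cast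
    refine le_trans ?_ (Finset.sum_le_sum fun m _ => ih m)
    rw [← Finset.sum_div, Finset.prod_range_succ, Nat.factorial_succ,
      div_le_div_iff₀ (by positivity) (by positivity)]
    have h1 := add_one_pow_succ_le_sum n (y / p)
    have h2 : (y : ℝ) + 1 ≤ p * (((y / p : ℕ) : ℝ) + 1) := by
      exact_mod_cast Nat.lt_mul_div_succ y (by omega : 0 < p)
    have h3 : ((y : ℝ) + 1) ^ (n + 1) ≤ (p * (((y / p : ℕ) : ℝ) + 1)) ^ (n + 1) :=
      pow_le_pow_left₀ (by positivity) h2 _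
    rw [mul_pow] at h3
    set S := ∑ m ∈ Finset.range (y / p + 1), ((m : ℝ) + 1) ^ n
    set D := ∏ i ∈ Finset.range n, (p : ℝ) ^ (i + 1)
    have hD : 0 < D := by positivity
    push_cast
    calc ((y : ℝ) + 1) ^ (n + 1) * (n.factorial * D)
        ≤ ((p : ℝ) ^ (n + 1) * ((n + 1) * S)) * (n.factorial * D) := by
          gcongr
          exact h3.trans (by gcongr)
      _ = S * ((n + 1) * n.factorial * (D * p ^ (n + 1))) := by ring

theorem sum_range_pow_succ_le {p : ℕ} (hp : 2 ≤ p) {q : ℝ} (hq0 : 0 ≤ q) (hq1 : q < 1) (n : ℕ) :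
    ∑ j ∈ Finset.range (p ^ (n + 1)), (ptilde p j : ℝ) * q ^ j ≤
      (1 - q)⁻¹ * ∑ m ∈ Finset.range (p ^ n), (ptilde p m : ℝ) * (q ^ p) ^ m := by
  have hp0 : 0 < p := by omega
  have h1 : ∀ j ∈ Finset.range (p ^ (n + 1)), (ptilde p j : ℝ) * q ^ j =
      ∑ m ∈ Finset.range (p ^ n), if p * m ≤ j then (ptilde p m : ℝ) * q ^ j else 0 := by
    intro j hj
    rw [← Finset.sum_filter, ptilde_eq_sum hp j, Nat.cast_sum, Finset.sum_mul]
    refine Finset.sum_congr ?_ fun _ _ => rfl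
    ext m
    rw [Finset.mem_range] at hj
    rw [Finset.mem_filter, Finset.mem_range, Finset.mem_range, Nat.lt_succ_iff,
      Nat.le_div_iff_mul_le hp0, mul_comm m p]
    refine ⟨fun h => ⟨?_, h⟩, fun h => h.2⟩
    rw [pow_succ'] at hj
    exact lt_of_mul_lt_mul_left (h.trans_lt hj) hp0.le
  rw [Finset.sum_congr rfl h1, Finset.sum_comm, Finset.mul_sum]
  refine Finset.sum_le_sum fun m _ => ?_
  rw [← Finset.sum_filter, ← Finset.mul_sum, ← pow_mul]
  have h2 : (Finset.range (p ^ (n + 1))).filter (fun j => p * m ≤ j) =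
      Finset.Ico (p * m) (p ^ (n + 1)) := by
    ext j
    simp only [Finset.mem_filter, Finset.mem_range, Finset.mem_Ico]
    tauto
  rw [h2]
  calc _ ≤ (ptilde p m : ℝ) * (q ^ (p * m) / (1 - q)) := by
        gcongr
        exact geom_sum_Ico_le_of_lt_one hq0 hq1
    _ = _ := by ring

theorem sum_range_pow_le_prod {p : ℕ} (hp : 2 ≤ p) (n : ℕ) : ∀ {q : ℝ}, 0 ≤ q → q < 1 →
    ∑ j ∈ Finset.range (p ^ n), (ptilde p j : ℝ) * q ^ j ≤
      ∏ i ∈ Finset.range n, (1 - q ^ p ^ i)⁻¹ := by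
  induction n with
  | zero => intro q _ _; simp [ptilde_zero]
  | succ n ih =>
    intro q hq0 hq1
    refine (sum_range_pow_succ_le hp hq0 hq1 n).trans ?_
    rw [Finset.prod_range_succ', mul_comm, pow_zero, pow_one]
    have := ih (pow_nonneg hq0 p) (pow_lt_one₀ hq0 hq1 (by omega))
    simp only [pow_succ', pow_mul]
    exact mul_le_mul_of_nonneg_right this (inv_nonneg.mpr (sub_nonneg.mpr hq1.le))

theorem prod_one_sub_pow_inv_le {p : ℕ} (hp : 2 ≤ p) (n : ℕ) {q : ℝ} (hq0 : 0 ≤ q)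
    (hq1 : q < 1) : ∏ i ∈ Finset.range n, (1 - q ^ p ^ i)⁻¹ ≤ Real.exp ((1 - q)⁻¹ ^ 2) := by
  have hq : 0 < 1 - q := sub_pos.mpr hq1
  have h1 : ∀ i ∈ Finset.range n, (1 - q ^ p ^ i)⁻¹ ≤ Real.exp (q ^ i * (1 - q)⁻¹) := by
    intro i _
    have hu : q ^ p ^ i ≤ q := pow_le_of_le_one hq0 hq1.le (pow_pos (by omega) i).ne'
    have hui : q ^ p ^ i ≤ q ^ i :=
      pow_le_pow_of_le_one hq0 hq1.le (Nat.lt_pow_self (by omega)).le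
    set u := q ^ p ^ i
    have hu0 : 0 ≤ u := by positivity
    have hu1 : 0 < 1 - u := by linarith
    calc (1 - u)⁻¹ = u * (1 - u)⁻¹ + 1 := by field_simp; ring
      _ ≤ Real.exp (u * (1 - u)⁻¹) := Real.add_one_le_exp _
      _ ≤ _ := by gcongr
  refine (Finset.prod_le_prod (fun i _ => inv_nonneg.mpr
    (sub_nonneg.mpr (pow_le_one₀ hq0 hq1.le))) h1).trans ?_
  rw [← Real.exp_sum, ← Finset.sum_mul, sq]
  gcongr
  have := geom_sum_Ico_le_of_lt_one (m := 0) (n := n) hq0 hq1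
  rwa [pow_zero, one_div, ← Finset.range_eq_Ico] at this

theorem sum_range_ptilde_mul_pow_le {p : ℕ} (hp : 2 ≤ p) {q : ℝ} (hq0 : 0 ≤ q) (hq1 : q < 1)
    (n : ℕ) : ∑ j ∈ Finset.range n, (ptilde p j : ℝ) * q ^ j ≤ Real.exp ((1 - q)⁻¹ ^ 2) := by
  refine le_trans ?_ ((sum_range_pow_le_prod hp n hq0 hq1).trans
    (prod_one_sub_pow_inv_le hp n hq0 hq1))
  exact Finset.sum_le_sum_of_subset_of_nonneg
    (Finset.range_mono (Nat.lt_pow_self (by omega)).le) fun _ _ _ => by positivity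

theorem summable_ptilde_mul_pow {p : ℕ} (hp : 2 ≤ p) {q : ℝ} (hq0 : 0 ≤ q) (hq1 : q < 1) :
    Summable fun j : ℕ => (ptilde p j : ℝ) * q ^ j :=
  summable_of_sum_range_le (fun _ => by positivity) (sum_range_ptilde_mul_pow_le hp hq0 hq1)

theorem tsum_ptilde_mul_pow_le {p : ℕ} (hp : 2 ≤ p) {q : ℝ} (hq0 : 0 ≤ q) (hq1 : q < 1) :
    ∑' j : ℕ, (ptilde p j : ℝ) * q ^ j ≤ Real.exp ((1 - q)⁻¹ ^ 2) :=
  Real.tsum_le_of_sum_range_le (fun _ => by positivity) (sum_range_ptilde_mul_pow_le hp hq0 hq1)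

theorem tsum_ptilde_mul_pow_le_mul {p : ℕ} (hp : 2 ≤ p) {q : ℝ} (hq0 : 0 ≤ q) (hq1 : q < 1) :
    ∑' j : ℕ, (ptilde p j : ℝ) * q ^ j ≤
      (1 - q)⁻¹ * ∑' j : ℕ, (ptilde p j : ℝ) * (q ^ p) ^ j := by
  have hq : 0 ≤ (1 - q)⁻¹ := inv_nonneg.mpr (sub_nonneg.mpr hq1.le)
  refine Real.tsum_le_of_sum_range_le (fun _ => by positivity) fun n => ?_
  calc _ ≤ ∑ j ∈ Finset.range (p ^ (n + 1)), (ptilde p j : ℝ) * q ^ j :=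
        Finset.sum_le_sum_of_subset_of_nonneg (Finset.range_mono
          ((Nat.lt_pow_self (by omega : 1 < p)).le.trans
            (Nat.pow_le_pow_right (by omega) n.le_succ))) fun _ _ _ => by positivity
    _ ≤ _ := sum_range_pow_succ_le hp hq0 hq1 n
    _ ≤ _ := by
      gcongr
      exact (summable_ptilde_mul_pow hp (pow_nonneg hq0 p)
        (pow_lt_one₀ hq0 hq1 (by omega))).sum_le_tsum _ fun _ _ => by positivity

theorem tsum_ptilde_mul_pow_le_prod_mul {p : ℕ} (hp : 2 ≤ p) (n : ℕ) : ∀ {q : ℝ}, 0 ≤ q → q < 1 →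
    ∑' j : ℕ, (ptilde p j : ℝ) * q ^ j ≤ (∏ i ∈ Finset.range n, (1 - q ^ p ^ i)⁻¹) *
      ∑' j : ℕ, (ptilde p j : ℝ) * (q ^ p ^ n) ^ j := by
  induction n with
  | zero => intro q _ _; simp
  | succ n ih =>
    intro q hq0 hq1
    refine (tsum_ptilde_mul_pow_le_mul hp hq0 hq1).trans ?_
    have := ih (pow_nonneg hq0 p) (pow_lt_one₀ hq0 hq1 (by omega))
    rw [Finset.prod_range_succ', mul_comm _ (1 - q ^ p ^ 0)⁻¹, pow_zero, pow_one, mul_assoc]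
    simp only [pow_succ', pow_mul]
    exact mul_le_mul_of_nonneg_left this (inv_nonneg.mpr (sub_nonneg.mpr hq1.le))

theorem Fp_eq_tsum_pow (p : ℕ) (x : ℝ) :
    Fp p x = ∑' j : ℕ, (ptilde p j : ℝ) * Real.exp (-1 / x) ^ j := by
  refine tsum_congr fun j => ?_
  rw [← Real.exp_nat_mul]
  congr 2
  ring

/-- The shift by `a` identifies `ℕ` with the natural numbers that are at least `a`. -/
def shiftEquiv (a : ℕ) : ℕ ≃ {l : ℕ // a ≤ l} where
  toFun m := ⟨a + m, Nat.le_add_right a m⟩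
  invFun l := l - a
  left_inv m := Nat.add_sub_cancel_left a m
  right_inv l := Subtype.ext (Nat.add_sub_cancel' l.2)

theorem ptilde_mul_pow_div_le_tsum {p : ℕ} (hp : 2 ≤ p) (a : ℕ) {q : ℝ} (hq0 : 0 ≤ q)
    (hq1 : q < 1) :
    (ptilde p a : ℝ) * q ^ a * (1 - q)⁻¹ ≤ ∑' l : {l : ℕ // a ≤ l}, (ptilde p l : ℝ) * q ^ (l : ℕ) := by
  rw [← (shiftEquiv a).tsum_eq, ← tsum_geometric_of_lt_one hq0 hq1, ← tsum_mul_left]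
  have hs := (summable_ptilde_mul_pow hp hq0 hq1).subtype {l : ℕ | a ≤ l}
  refine Summable.tsum_le_tsum (fun m => ?_)
    ((summable_geometric_of_lt_one hq0 hq1).mul_left _) ((shiftEquiv a).summable_iff.mpr hs)
  change _ ≤ (ptilde p (a + m) : ℝ) * q ^ (a + m)
  rw [pow_add, ← mul_assoc]
  gcongr
  exact ptilde_mono hp (Nat.le_add_right a m)

theorem one_le_tsum_ptilde_mul_pow {p : ℕ} (hp : 2 ≤ p) {q : ℝ} (hq0 : 0 ≤ q) (hq1 : q < 1) :
    1 ≤ ∑' j : ℕ, (ptilde p j : ℝ) * q ^ j := by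
  have := (summable_ptilde_mul_pow hp hq0 hq1).le_tsum 0 fun _ _ => by positivity
  simpa [ptilde_zero] using this

theorem div_one_add_le_one_sub_exp_neg {u : ℝ} (hu : 0 ≤ u) :
    u / (1 + u) ≤ 1 - Real.exp (-u) := by
  have h : Real.exp (-u) ≤ (1 + u)⁻¹ := by
    rw [Real.exp_neg]
    gcongr
    linarith [Real.add_one_le_exp u]
  have h2 : u / (1 + u) = 1 - (1 + u)⁻¹ := by field_simp; ring
  linarith

/-- With `T = p ^ (s + 1) * t`, a lower bound for the proportion of the series `Fp` carried by the
terms of index at least `p ^ (s + 1)`. -/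
theorem le_tail_div_tsum {p : ℕ} (hp : 2 ≤ p) (s : ℕ) {t T : ℝ} (ht : 0 < t)
    (hT : T = (p : ℝ) ^ (s + 1) * t) (hT1 : 1 ≤ T) :
    Real.exp (-4) * (T ^ s / s.factorial) * Real.exp (-T) /
        ∏ j ∈ Finset.range s, (1 + T / (p : ℝ) ^ (j + 1)) ≤
      (∑' l : {l : ℕ // p ^ (s + 1) ≤ l}, (ptilde p l : ℝ) * Real.exp (-t) ^ (l : ℕ)) /
        ∑' j : ℕ, (ptilde p j : ℝ) * Real.exp (-t) ^ j := by
  set q := Real.exp (-t) with hq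
  have hp0 : (0 : ℝ) < p := by exact_mod_cast (by omega : 0 < p)
  have hq0 : 0 < q := Real.exp_pos _
  have hq1 : q < 1 := by rw [hq, Real.exp_lt_one_iff]; linarith
  have hqi : 0 < (1 - q)⁻¹ := inv_pos.mpr (sub_pos.mpr hq1)
  have hqpow : ∀ n : ℕ, q ^ n = Real.exp (-(n * t)) := fun n => by
    rw [hq, ← Real.exp_nat_mul]; ring_nf
  have hqT : q ^ p ^ (s + 1) = Real.exp (-T) := by
    rw [hqpow, hT]; push_cast; rfl
  have hexp : Real.exp (-T) ≤ 1 / 2 := by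
    have h := Real.add_one_le_exp T
    rw [Real.exp_neg, ← one_div]
    exact one_div_le_one_div_of_le (by norm_num) (by linarith)
  set P := ∏ i ∈ Finset.range s, (1 - q ^ p ^ (i + 1)) with hP
  have hfac : ∀ i : ℕ, 0 < 1 - q ^ p ^ (i + 1) := fun i =>
    sub_pos.mpr (pow_lt_one₀ hq0.le hq1 (by positivity))
  have hP0 : 0 < P := Finset.prod_pos fun i _ => hfac i
  have hden : ∑' j : ℕ, (ptilde p j : ℝ) * q ^ j ≤ P⁻¹ * (1 - q)⁻¹ * Real.exp 4 := by
    refine (tsum_ptilde_mul_pow_le_prod_mul hp (s + 1) hq0.le hq1).trans ?_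
    rw [Finset.prod_range_succ', Finset.prod_inv_distrib, ← hP, pow_zero, pow_one, hqT]
    gcongr
    refine (tsum_ptilde_mul_pow_le hp (Real.exp_nonneg _) (by linarith)).trans ?_
    gcongr
    have h2 : (1 - Real.exp (-T))⁻¹ ≤ 2 := by
      rw [inv_le_comm₀ (by linarith) (by norm_num)]
      linarith
    have h3 : 0 < (1 - Real.exp (-T))⁻¹ := inv_pos.mpr (by linarith)
    nlinarith
  set D := ∏ i ∈ Finset.range s, (p : ℝ) ^ (i + 1) with hD
  have hD0 : 0 < D := by positivity
  set R := ∏ j ∈ Finset.range s, (1 + T / (p : ℝ) ^ (j + 1)) with hR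
  have hR0 : 0 < R := Finset.prod_pos fun j _ => by positivity
  have hPlow : t ^ s * D / R ≤ P := by
    have h1 : R = ∏ i ∈ Finset.range s, (1 + t * (p : ℝ) ^ (i + 1)) := by
      rw [hR, ← Finset.prod_range_reflect]
      refine Finset.prod_congr rfl fun i hi => ?_
      rw [Finset.mem_range] at hi
      have h : (p : ℝ) ^ (s + 1) = (p : ℝ) ^ (i + 1) * (p : ℝ) ^ (s - 1 - i + 1) := by
        rw [← pow_add]; congr 1; omega
      rw [hT, h]
      field_simp
    have h2 : t ^ s * D = ∏ i ∈ Finset.range s, t * (p : ℝ) ^ (i + 1) := by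
      rw [Finset.prod_mul_distrib, Finset.prod_const, Finset.card_range]
    rw [h1, h2, ← Finset.prod_div_distrib]
    refine Finset.prod_le_prod (fun i _ => by positivity) fun i _ => ?_
    refine (div_one_add_le_one_sub_exp_neg (by positivity)).trans_eq ?_
    rw [hqpow]
    push_cast
    ring_nf
  have hnum : ((p : ℝ) ^ (s + 1)) ^ s / (s.factorial * D) ≤ ptilde p (p ^ (s + 1)) := by
    refine le_trans ?_ (pow_div_le_ptilde hp s (p ^ (s + 1)))
    push_cast
    gcongr
    linarith
  have hF1 := one_le_tsum_ptilde_mul_pow hp hq0.le hq1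
  rw [le_div_iff₀ (by linarith)]
  refine le_trans ?_ (ptilde_mul_pow_div_le_tsum hp (p ^ (s + 1)) hq0.le hq1)
  rw [hqT]
  calc _ ≤ Real.exp (-4) * (T ^ s / s.factorial) * Real.exp (-T) / R *
        (P⁻¹ * (1 - q)⁻¹ * Real.exp 4) := by gcongr
    _ = (T ^ s / s.factorial / R * P⁻¹) * Real.exp (-T) * (1 - q)⁻¹ := by
      rw [Real.exp_neg 4]
      field_simp
    _ ≤ ((p : ℝ) ^ (s + 1)) ^ s / (s.factorial * D) * Real.exp (-T) * (1 - q)⁻¹ := by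
      gcongr
      rw [← div_eq_mul_inv, div_le_iff₀ hP0]
      refine le_trans (le_of_eq ?_) (mul_le_mul_of_nonneg_left hPlow (by positivity))
      rw [hT, mul_pow]
      field_simp
    _ ≤ _ := by gcongr

theorem tsum_tail_le {p : ℕ} (hp : 2 ≤ p) {a k : ℕ} (ha : 1 ≤ a) (hk : 1 ≤ k) {q : ℝ}
    (hq0 : 0 ≤ q) (hq1 : q < 1) :
    ∑' l : {l : ℕ // a ≤ l}, (ptilde p l : ℝ) * (q ^ k) ^ (l : ℕ) ≤
      q ^ (k - 1) * ∑' j : ℕ, (ptilde p j : ℝ) * q ^ j := by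
  have hs := summable_ptilde_mul_pow hp hq0 hq1
  have hs' := summable_ptilde_mul_pow hp (pow_nonneg hq0 k) (pow_lt_one₀ hq0 hq1 (by omega))
  calc _ ≤ ∑' l : {l : ℕ // a ≤ l}, q ^ (k - 1) * ((ptilde p l : ℝ) * q ^ (l : ℕ)) := by
        refine Summable.tsum_le_tsum (fun l => ?_) (hs'.subtype {l : ℕ | a ≤ l})
          ((hs.subtype {l : ℕ | a ≤ l}).mul_left _)
        have hle : k - 1 + (l : ℕ) ≤ k * l := by
          obtain ⟨k, rfl⟩ := Nat.exists_eq_add_of_le' hk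
          have := l.2
          rw [Nat.add_sub_cancel]
          nlinarith
        rw [mul_left_comm, ← pow_add, ← pow_mul]
        gcongr ?_ * ?_
        exact pow_le_pow_of_le_one hq0 hq1.le hle
    _ = q ^ (k - 1) * ∑' l : {l : ℕ // a ≤ l}, (ptilde p l : ℝ) * q ^ (l : ℕ) := tsum_mul_left
    _ ≤ _ := by
      gcongr
      exact hs.tsum_subtype_le _ {l : ℕ | a ≤ l} fun _ => by positivity

theorem exists_coprime_le_succ {p : ℕ} (hp : p.Prime) (n : ℕ) :
    ∃ m, n ≤ m ∧ m ≤ n + 1 ∧ Nat.Coprime m p := by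
  by_cases h : p ∣ n
  · refine ⟨n + 1, n.le_succ, le_rfl, Nat.Coprime.symm ((hp.coprime_iff_not_dvd).mpr fun h' => ?_)⟩
    exact hp.one_lt.ne' (Nat.dvd_one.mp ((Nat.dvd_add_right h).mp h'))
  · exact ⟨n, le_rfl, n.le_succ, Nat.Coprime.symm ((hp.coprime_iff_not_dvd).mpr h)⟩

theorem mul_le_tsum_coprime {p : ℕ} (hp : p.Prime) {K b : ℝ} (n : ℕ) {f : ℕ → ℝ}
    (hs : Summable fun k : {k : ℕ // K ≤ (k : ℝ) ∧ Nat.Coprime k p} => f k)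
    (hf : ∀ k : ℕ, K ≤ k → 0 ≤ f k) (hK : 0 ≤ K)
    (hb : ∀ k : ℕ, K ≤ k → k ≤ K + 2 * n → b ≤ f k) :
    n * b ≤ ∑' k : {k : ℕ // K ≤ (k : ℝ) ∧ Nat.Coprime k p}, f k := by
  choose g hg1 hg2 hg3 using fun i : Fin n => exists_coprime_le_succ hp (⌈K⌉₊ + 2 * (i : ℕ))
  have hKg : ∀ i, K ≤ g i := fun i =>
    Nat.ceil_le.mp (by have := hg1 i; omega)
  let G : Fin n → {k : ℕ // K ≤ (k : ℝ) ∧ Nat.Coprime k p} := fun i => ⟨g i, hKg i, hg3 i⟩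
  have hG : Function.Injective G := by
    intro i j hij
    have h : g i = g j := congrArg Subtype.val hij
    have h1 := hg1 i
    have h2 := hg2 i
    have h3 := hg1 j
    have h4 := hg2 j
    exact Fin.ext (by omega)
  have hle := tsum_comp_le_tsum_of_inj hs (fun k => hf k k.2.1) hG
  refine le_trans ?_ hle
  rw [tsum_fintype]
  have h : ∀ i ∈ (Finset.univ : Finset (Fin n)), b ≤ f (g i) := by
    intro i _
    refine hb _ (hKg i) ?_
    have h1 : g i + 1 ≤ ⌈K⌉₊ + 2 * n := by have := hg2 i; have := i.2; omega
    have h2 : (g i : ℝ) + 1 ≤ ⌈K⌉₊ + 2 * n := by exact_mod_cast h1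
    linarith [Nat.ceil_lt_add_one hK]
  simpa using Finset.card_nsmul_le_sum _ _ _ h

theorem prod_one_add_div_pow_le {p : ℕ} (hp : 2 ≤ p) {T : ℝ} (hT : 0 ≤ T) {J : ℕ}
    (hJ : T ≤ (p : ℝ) ^ J) (s : ℕ) :
    ∏ j ∈ Finset.range s, (1 + T / (p : ℝ) ^ (j + 1)) ≤ (1 + T) ^ J * Real.exp 1 := by
  have hp0 : (0 : ℝ) < p := by exact_mod_cast (by omega : 0 < p)
  have hp2 : (2 : ℝ) ≤ p := by exact_mod_cast hp
  calc _ ≤ ∏ j ∈ Finset.range (J + s), (1 + T / (p : ℝ) ^ (j + 1)) := by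
        refine Finset.prod_le_prod_of_subset_of_one_le (Finset.range_mono (by omega))
          (fun _ _ => by positivity) fun j _ _ => ?_
        have : 0 ≤ T / (p : ℝ) ^ (j + 1) := by positivity
        linarith
    _ = (∏ j ∈ Finset.range J, (1 + T / (p : ℝ) ^ (j + 1))) *
        ∏ j ∈ Finset.range s, (1 + T / (p : ℝ) ^ (J + j + 1)) := Finset.prod_range_add _ _ _
    _ ≤ (1 + T) ^ J * Real.exp 1 := by
      gcongr
      · calc _ ≤ ∏ j ∈ Finset.range J, (1 + T) := by
              refine Finset.prod_le_prod (fun _ _ => by positivity) fun j _ => ?_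
              gcongr
              exact div_le_self hT (one_le_pow₀ (by linarith))
          _ = _ := by simp
      · calc _ ≤ ∏ j ∈ Finset.range s, Real.exp ((1 / 2) ^ (j + 1)) := by
              refine Finset.prod_le_prod (fun _ _ => by positivity) fun j _ => ?_
              have h : T / (p : ℝ) ^ (J + j + 1) ≤ (1 / 2) ^ (j + 1) := by
                rw [div_le_iff₀ (by positivity), add_assoc, pow_add]
                calc T ≤ (p : ℝ) ^ J * 1 := by rwa [mul_one]
                  _ ≤ (p : ℝ) ^ J * (p / 2) ^ (j + 1) := by
                    gcongr
                    exact one_le_pow₀ (by linarith)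
                  _ = _ := by rw [div_pow, div_pow, one_pow]; ring
              linarith [Real.add_one_le_exp ((1 / 2 : ℝ) ^ (j + 1))]
          _ = Real.exp (∑ j ∈ Finset.range s, (1 / 2) ^ (j + 1)) := (Real.exp_sum _ _).symm
          _ ≤ _ := by
            gcongr
            simp only [pow_succ]
            rw [← Finset.sum_mul]
            have := geom_sum_Ico_le_of_lt_one (x := (1 / 2 : ℝ)) (m := 0) (n := s)
              (by norm_num) (by norm_num)
            rw [← Finset.range_eq_Ico] at this
            norm_num at this ⊢
            linarith

theorem exists_log_sq_div_log_le {δ : ℝ} (hδ : 0 < δ) :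
    ∃ L₀ : ℝ, ∀ L ≥ L₀, ∀ p : ℕ, 2 ≤ p → (p : ℝ) ≤ L / Real.log L ^ 2 →
      3 * (Real.log L ^ 2 / Real.log p) ≤ δ * L / p := by
  set P := Real.exp (3 / δ) with hP
  have hP0 : 0 < P := Real.exp_pos _
  have hl2 : 0 < Real.log 2 := Real.log_pos (by norm_num)
  have hε : 0 < δ * Real.log 2 / (3 * P) := by positivity
  have h := (Real.isLittleO_pow_log_id_atTop (n := 2)).bound hε
  obtain ⟨L₀, hL₀⟩ := Filter.eventually_atTop.mp h
  refine ⟨max L₀ 2, fun L hL p hp hpL => ?_⟩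
  have hL2 : 2 ≤ L := (le_max_right _ _).trans hL
  have hlL : 0 < Real.log L := Real.log_pos (by linarith)
  have hp2 : (2 : ℝ) ≤ p := by exact_mod_cast hp
  have hlp : Real.log 2 ≤ Real.log p := Real.log_le_log (by norm_num) hp2
  rw [← mul_div_assoc, div_le_div_iff₀ (by linarith) (by linarith)]
  rcases le_total P p with hPp | hPp
  · have h1 : 3 / δ ≤ Real.log p := by
      rw [← Real.log_exp (3 / δ)]
      exact Real.log_le_log (Real.exp_pos _) hPp
    rw [div_le_iff₀ hδ] at h1
    rw [le_div_iff₀ (by positivity)] at hpL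
    calc 3 * Real.log L ^ 2 * p = 3 * (p * Real.log L ^ 2) := by ring
      _ ≤ (Real.log p * δ) * L := by gcongr
      _ = _ := by ring
  · have h1 := hL₀ L ((le_max_left _ _).trans hL)
    rw [Real.norm_of_nonneg (by positivity), id, Real.norm_of_nonneg (by linarith)] at h1
    calc 3 * Real.log L ^ 2 * p ≤ 3 * (δ * Real.log 2 / (3 * P) * L) * P := by gcongr
      _ = δ * L * Real.log 2 := by field_simp
      _ ≤ _ := by gcongr

theorem pow_le_pow_div_factorial {a T : ℝ} {s : ℕ} (ha : 0 ≤ a) (h : a * s ≤ T) :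
    a ^ s ≤ T ^ s / s.factorial := by
  rw [le_div_iff₀ (by positivity)]
  calc a ^ s * s.factorial ≤ a ^ s * (s : ℝ) ^ s := by
        gcongr
        exact_mod_cast Nat.factorial_le_pow s
    _ = (a * s) ^ s := (mul_pow _ _ _).symm
    _ ≤ _ := by gcongr

theorem summable_tail_div_tsum {p a : ℕ} (hp : 2 ≤ p) (ha : 1 ≤ a) {q : ℝ} (hq0 : 0 ≤ q)
    (hq1 : q < 1) {S : Set ℕ} (hS : ∀ k ∈ S, 1 ≤ k) :
    Summable fun k : S =>
      (∑' l : {l : ℕ // a ≤ l}, (ptilde p l : ℝ) * (q ^ (k : ℕ)) ^ (l : ℕ)) /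
        ∑' j : ℕ, (ptilde p j : ℝ) * (q ^ (k : ℕ)) ^ j := by
  refine Summable.of_nonneg_of_le (f := fun k : S => q ^ ((k : ℕ) - 1) *
    ∑' j : ℕ, (ptilde p j : ℝ) * q ^ j) (fun k => ?_) (fun k => ?_) ?_
  · exact div_nonneg (tsum_nonneg fun _ => by positivity) (tsum_nonneg fun _ => by positivity)
  · have hk := hS k k.2
    refine le_trans (div_le_self (tsum_nonneg fun _ => by positivity) ?_)
      (tsum_tail_le hp ha hk hq0 hq1)
    exact one_le_tsum_ptilde_mul_pow hp (pow_nonneg hq0 _) (pow_lt_one₀ hq0 hq1 (by omega))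
  · refine Summable.mul_right _ ?_
    have h : Summable fun k : ℕ => q ^ (k - 1) :=
      (summable_nat_add_iff 1).mp (summable_geometric_of_lt_one hq0 hq1)
    exact h.subtype S

theorem prod_one_add_div_pow_le_exp {p : ℕ} (hp : 2 ≤ p) {L T : ℝ} (hT : 0 ≤ T) (hTL : 1 + T ≤ L)
    (hpL : (p : ℝ) ≤ L) (s : ℕ) :
    ∏ j ∈ Finset.range s, (1 + T / (p : ℝ) ^ (j + 1)) ≤
      Real.exp (2 * (Real.log L ^ 2 / Real.log p) + 1) := by
  have hp2 : (2 : ℝ) ≤ p := by exact_mod_cast hp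
  have hlp : 0 < Real.log p := Real.log_pos (by linarith)
  have hlpL : Real.log p ≤ Real.log L := Real.log_le_log (by linarith) hpL
  have hlL : 0 < Real.log L := by linarith
  have hL : L = Real.exp (Real.log L) := (Real.exp_log (by linarith)).symm
  set J := ⌈Real.log L / Real.log p⌉₊ with hJ
  have hJle : Real.log L ≤ J * Real.log p := by
    rw [← div_le_iff₀ hlp]
    exact Nat.le_ceil _
  have hJle2 : (J : ℝ) ≤ 2 * (Real.log L / Real.log p) := by
    have h1 : (J : ℝ) < Real.log L / Real.log p + 1 := Nat.ceil_lt_add_one (by positivity)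
    have h2 : 1 ≤ Real.log L / Real.log p := (one_le_div hlp).mpr hlpL
    linarith
  have hTp : T ≤ (p : ℝ) ^ J := by
    rw [← Real.exp_log (by linarith : (0 : ℝ) < p), ← Real.exp_nat_mul]
    refine le_trans (by linarith : T ≤ L) ?_
    conv_lhs => rw [hL]
    exact Real.exp_le_exp.mpr hJle
  refine (prod_one_add_div_pow_le hp hT hTp s).trans ?_
  rw [Real.exp_add]
  gcongr
  calc (1 + T) ^ J ≤ L ^ J := by gcongr
    _ = Real.exp (J * Real.log L) := by
      conv_lhs => rw [hL]
      rw [← Real.exp_nat_mul]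
    _ ≤ _ := by
      refine Real.exp_le_exp.mpr ?_
      calc (J : ℝ) * Real.log L ≤ 2 * (Real.log L / Real.log p) * Real.log L := by gcongr
        _ = _ := by ring

theorem natCast_pow_le_exp {p r : ℕ} (hp : 2 ≤ p) {L : ℝ} (hL : 0 ≤ L)
    (hr : (r : ℝ) ≤ L / (2 * Real.exp 1 * p)) : (p : ℝ) ^ r ≤ Real.exp (L / 5) := by
  have hp0 : (0 : ℝ) < p := by exact_mod_cast (by omega : 0 < p)
  have he := Real.exp_one_gt_d9
  rw [← Real.exp_log hp0, ← Real.exp_nat_mul]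
  refine Real.exp_le_exp.mpr ?_
  have h1 : Real.log p ≤ p := (Real.log_le_sub_one_of_pos hp0).trans (by linarith)
  calc (r : ℝ) * Real.log p ≤ L / (2 * Real.exp 1 * p) * p := by gcongr
    _ = L / (2 * Real.exp 1) := by field_simp
    _ ≤ L / 5 := by gcongr; linarith

theorem exp_half_div_two_le {N : ℝ} (hN : 0 < N) :
    Real.exp (Real.log N / 2) / 2 ≤ Real.sqrt (6 * N) / Real.pi := by
  have h1 : Real.exp (Real.log N / 2) = Real.sqrt N := by
    rw [← Real.log_sqrt hN.le, Real.exp_log (Real.sqrt_pos.mpr hN)]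
  have h2 : 2 * Real.sqrt N ≤ Real.sqrt (6 * N) := by
    apply Real.le_sqrt_of_sq_le
    rw [mul_pow, Real.sq_sqrt hN.le]
    linarith
  rw [h1, div_le_div_iff₀ (by norm_num) Real.pi_pos]
  nlinarith [Real.pi_le_four, Real.sqrt_nonneg N]

/-- The numerical estimate behind `Delta_lower_bound`: here `n` counts the values of `k` that are
used, `T` is `p ^ r * K / x`, and `M` is `x / p ^ r`. -/
theorem exp_le_count_mul {p s n : ℕ} (hp : 2 ≤ p) {L M T : ℝ} (hL : 20 ≤ L) (hpL : (p : ℝ) ≤ L)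
    (hr1 : ((s + 1 : ℕ) : ℝ) ≤ L / (2 * Real.exp 1 * p))
    (hr2 : L / (2 * Real.exp 1 * p) < ((s + 1 : ℕ) : ℝ) + 1)
    (hM : Real.exp (L / 2) / 2 / (p : ℝ) ^ (s + 1) ≤ M)
    (hn : M / 4 ≤ n) (hT : T = L / 2 * (1 + 1 / (5 * (p : ℝ))))
    (hδ : 3 * (Real.log L ^ 2 / Real.log p) ≤
      (1 / (2 * Real.exp 1) - 1 / 10 - 1 / 12) * L / p) :
    Real.exp (-8) / 8 * Real.exp (L * (1 / (12 * p))) ≤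
      n * (Real.exp (-4) * (T ^ s / s.factorial) * Real.exp (-(T + 1)) /
        Real.exp (2 * (Real.log L ^ 2 / Real.log p) + 1)) := by
  have hp2 : (2 : ℝ) ≤ p := by exact_mod_cast hp
  have hp0 : (0 : ℝ) < p := by linarith
  set E := Real.log L ^ 2 / Real.log p with hE
  have hlp : 0 < Real.log p := Real.log_pos (by linarith)
  have hlpL : Real.log p ≤ Real.log L := Real.log_le_log (by linarith) hpL
  have hlpE : Real.log p ≤ E := by
    rw [hE, le_div_iff₀ hlp]
    nlinarith
  have hTL : L / 2 ≤ T := by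
    rw [hT]
    have : 0 ≤ 1 / (5 * (p : ℝ)) := by positivity
    nlinarith
  have hTe : T = L / 2 + L * (1 / (10 * p)) := by rw [hT]; field_simp; ring
  have hpow : (Real.exp 1 * p) ^ s ≤ T ^ s / s.factorial := by
    refine pow_le_pow_div_factorial (by positivity) (le_trans ?_ hTL)
    rw [le_div_iff₀ (by positivity)] at hr1
    push_cast at hr1
    nlinarith [mul_pos (Real.exp_pos 1) hp0]
  have hs : Real.exp (L / (2 * Real.exp 1 * p) - 2) ≤ Real.exp s := by
    gcongr
    push_cast at hr2
    linarith
  have hpexp : (p : ℝ)⁻¹ = Real.exp (-Real.log p) := by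
    rw [Real.exp_neg, Real.exp_log hp0]
  calc Real.exp (-8) / 8 * Real.exp (L * (1 / (12 * p)))
      = 1 / 8 * Real.exp (-8 + L * (1 / (12 * p))) := by rw [Real.exp_add]; ring
    _ ≤ 1 / 8 * Real.exp (L / 2 + (L / (2 * Real.exp 1 * p) - 2) + -Real.log p + -4 + -(T + 1) +
          -(2 * E + 1)) := by
        refine mul_le_mul_of_nonneg_left (Real.exp_le_exp.mpr ?_) (by norm_num)
        have h : (1 / (2 * Real.exp 1) - 1 / 10 - 1 / 12) * L / p =
            L / (2 * Real.exp 1 * p) - L * (1 / (10 * p)) - L * (1 / (12 * p)) := by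
          field_simp
        rw [h] at hδ
        rw [hTe]
        linarith
    _ = 1 / 8 * (Real.exp (L / 2) * Real.exp (L / (2 * Real.exp 1 * p) - 2) * (p : ℝ)⁻¹ *
          Real.exp (-4) * Real.exp (-(T + 1)) * (Real.exp (2 * E + 1))⁻¹) := by
        rw [Real.exp_add _ (-(2 * E + 1)), Real.exp_add _ (-(T + 1)), Real.exp_add _ (-4),
          Real.exp_add _ (-Real.log p), Real.exp_add (L / 2), ← hpexp, Real.exp_neg (2 * E + 1)]
    _ ≤ 1 / 8 * (Real.exp (L / 2) * Real.exp s * (p : ℝ)⁻¹ *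
          Real.exp (-4) * Real.exp (-(T + 1)) * (Real.exp (2 * E + 1))⁻¹) := by gcongr
    _ = (Real.exp (L / 2) / 2 / (p : ℝ) ^ (s + 1)) / 4 *
          (Real.exp (-4) * (Real.exp 1 * p) ^ s * Real.exp (-(T + 1)) /
            Real.exp (2 * E + 1)) := by
        rw [mul_pow, ← Real.exp_nat_mul, mul_one, pow_succ]
        field_simp
        ring
    _ ≤ n * _ := by
        gcongr
        linarith

/-- There exist absolute constants `c > 0` and `N₀` such that for all
`N ≥ N₀` and every prime `p ≤ (log N)/(log log N)²`, with `r = ⌊(log N)/(2ep)⌋`,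
`x = √(6N)/π` and `K = (√(6N)/(2π·p^r))·(log N)·(1 + 1/(5p))`, one has
`Δ := ∑_{k ≥ K, (k,p)=1} ∑_{ℓ ≥ p^r} p̃(ℓ)·e^(−ℓk/x) / F_p(x/k) ≥ c·N^(1/(12p))`. -/
theorem Delta_lower_bound :
    ∃ c : ℝ, 0 < c ∧ ∃ N₀ : ℕ, ∀ N : ℕ, N₀ ≤ N → ∀ p : ℕ, p.Prime →
      (p : ℝ) ≤ Real.log N / (Real.log (Real.log N)) ^ 2 →
      ∀ r : ℕ, r = ⌊Real.log N / (2 * Real.exp 1 * p)⌋₊ →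
      ∀ x : ℝ, x = Real.sqrt (6 * N) / Real.pi →
      ∀ K : ℝ, K = Real.sqrt (6 * N) / (2 * Real.pi * (p : ℝ) ^ r) * Real.log N *
        (1 + 1 / (5 * (p : ℝ))) →
      c * (N : ℝ) ^ ((1 : ℝ) / (12 * (p : ℝ))) ≤
        ∑' k : {k : ℕ // K ≤ (k : ℝ) ∧ Nat.Coprime k p},
          (∑' ℓ : {ℓ : ℕ // p ^ r ≤ ℓ},
            (ptilde p (ℓ : ℕ) : ℝ) * Real.exp (-((ℓ : ℕ) : ℝ) * ((k : ℕ) : ℝ) / x)) /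
            Fp p (x / ((k : ℕ) : ℝ)) := by
  have he1 := Real.exp_one_gt_d9
  have he2 := Real.exp_one_lt_d9
  have hδ : 0 < 1 / (2 * Real.exp 1) - 1 / 10 - 1 / 12 := by
    have : 1 / (2 * 2.7182818286) < 1 / (2 * Real.exp 1) :=
      one_div_lt_one_div_of_lt (by positivity) (by linarith)
    norm_num at this ⊢
    linarith
  obtain ⟨L₀, hL₀⟩ := exists_log_sq_div_log_le hδ
  refine ⟨Real.exp (-8) / 8, by positivity, ⌈Real.exp (max L₀ (max 20 (Real.exp 3)))⌉₊, ?_⟩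
  intro N hN p hp hpL r hr x hx K hK
  have hN' := Nat.ceil_le.mp hN
  have hN0 : (0 : ℝ) < N := (Real.exp_pos _).trans_le hN'
  have hLmax : max L₀ (max 20 (Real.exp 3)) ≤ Real.log N := (Real.le_log_iff_exp_le hN0).mpr hN'
  set L := Real.log N with hLdef
  have hLL₀ : L₀ ≤ L := (le_max_left _ _).trans hLmax
  have hL20 : 20 ≤ L := ((le_max_left _ _).trans (le_max_right _ _)).trans hLmax
  have hL3 : 3 ≤ Real.log L := (Real.le_log_iff_exp_le (by linarith)).mpr
    (((le_max_right _ _).trans (le_max_right _ _)).trans hLmax)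
  have hp2 := hp.two_le
  have hp0 : (0 : ℝ) < p := by exact_mod_cast hp.pos
  have hp2' : (2 : ℝ) ≤ p := by exact_mod_cast hp2
  have hpL' : (p : ℝ) * 9 ≤ L := by
    rw [le_div_iff₀ (by positivity)] at hpL
    have h9 : 9 ≤ Real.log L ^ 2 := by nlinarith
    exact (mul_le_mul_of_nonneg_left h9 hp0.le).trans hpL
  have hR1 : 1 ≤ L / (2 * Real.exp 1 * p) := by
    rw [le_div_iff₀ (by positivity)]
    nlinarith
  have hr1 : (r : ℝ) ≤ L / (2 * Real.exp 1 * p) := by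
    rw [hr]; exact Nat.floor_le (by linarith)
  have hr2 : L / (2 * Real.exp 1 * p) < (r : ℝ) + 1 := by
    rw [hr]; exact Nat.lt_floor_add_one _
  have hr0 : 1 ≤ r := by rw [hr]; exact Nat.le_floor (by exact_mod_cast hR1)
  clear hr
  obtain ⟨s, rfl⟩ := Nat.exists_eq_add_of_le' hr0
  have hpr : (0 : ℝ) < (p : ℝ) ^ (s + 1) := by positivity
  set M := x / (p : ℝ) ^ (s + 1) with hM
  set T := L / 2 * (1 + 1 / (5 * (p : ℝ))) with hT
  have hKMT : K = M * T := by
    rw [hK, hM, hT, hx]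
    field_simp
  have hxlow : Real.exp (L / 2) / 2 ≤ x := hx ▸ exp_half_div_two_le hN0
  have hx0 : 0 < x := lt_of_lt_of_le (by positivity) hxlow
  have hMlow : Real.exp (L / 2) / 2 / (p : ℝ) ^ (s + 1) ≤ M := by rw [hM]; gcongr
  have hM2 : 2 ≤ M := by
    refine le_trans ?_ hMlow
    rw [le_div_iff₀ hpr, le_div_iff₀ (by norm_num)]
    have h1 := natCast_pow_le_exp hp2 (by linarith) hr1
    have h2 : (4 : ℝ) ≤ Real.exp (3 / 10 * L) := by
      linarith [Real.add_one_le_exp (3 / 10 * L)]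
    calc (2 : ℝ) * (p : ℝ) ^ (s + 1) * 2 = 4 * (p : ℝ) ^ (s + 1) := by ring
      _ ≤ Real.exp (3 / 10 * L) * Real.exp (L / 5) := by gcongr
      _ = Real.exp (L / 2) := by rw [← Real.exp_add]; ring_nf
  have hTlow : L / 2 ≤ T := by
    have : 0 ≤ 1 / (5 * (p : ℝ)) := by positivity
    rw [hT]
    nlinarith
  have hThigh : T + 2 ≤ L := by
    have : 1 / (5 * (p : ℝ)) ≤ 1 / 10 := one_div_le_one_div_of_le (by norm_num) (by linarith)
    rw [hT]
    nlinarith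
  have hKpos : 0 < K := by rw [hKMT]; nlinarith
  set q := Real.exp (-1 / x) with hq
  have hq0 : 0 < q := Real.exp_pos _
  have hq1 : q < 1 := by
    rw [hq, Real.exp_lt_one_iff]
    exact div_neg_of_neg_of_pos (by norm_num) hx0
  have hqk : ∀ k : ℕ, q ^ k = Real.exp (-(k / x)) := fun k => by
    rw [hq, ← Real.exp_nat_mul]; ring_nf
  let f : ℕ → ℝ := fun k =>
    (∑' l : {l : ℕ // p ^ (s + 1) ≤ l}, (ptilde p l : ℝ) * (q ^ k) ^ (l : ℕ)) /
      ∑' j : ℕ, (ptilde p j : ℝ) * (q ^ k) ^ j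
  have hfun : ∀ k : ℕ, (∑' l : {l : ℕ // p ^ (s + 1) ≤ l},
      (ptilde p (l : ℕ) : ℝ) * Real.exp (-((l : ℕ) : ℝ) * (k : ℝ) / x)) /
        Fp p (x / (k : ℝ)) = f k := by
    intro k
    have h : -1 / (x / (k : ℝ)) = -(k / x) := by rw [div_div_eq_mul_div]; ring
    rw [Fp_eq_tsum_pow, h, ← hqk]
    congr 1
    refine tsum_congr fun l => ?_
    rw [hqk, ← Real.exp_nat_mul]
    ring_nf
  simp only [hfun]
  have hk1 : ∀ k : ℕ, K ≤ k → 1 ≤ k := fun k hk => by exact_mod_cast hKpos.trans_le hk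
  refine le_trans ?_ (mul_le_tsum_coprime hp ⌊M / 2⌋₊ (b := Real.exp (-4) * (T ^ s / s.factorial) *
    Real.exp (-(T + 1)) / Real.exp (2 * (Real.log L ^ 2 / Real.log p) + 1)) ?_ ?_ hKpos.le ?_)
  · rw [Real.rpow_def_of_pos hN0]
    refine exp_le_count_mul hp2 hL20 (by linarith) hr1 hr2 hMlow ?_ hT
      (hL₀ L hLL₀ p hp2 hpL)
    have h1 := Nat.lt_floor_add_one (M / 2)
    have h2 : (1 : ℝ) ≤ ⌊M / 2⌋₊ := by
      exact_mod_cast Nat.le_floor (by push_cast; linarith)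
    linarith
  · exact summable_tail_div_tsum hp2 (Nat.pow_pos hp.pos) hq0.le hq1
      (S := {k : ℕ | K ≤ (k : ℝ) ∧ Nat.Coprime k p}) fun k hk => hk1 k hk.1
  · intro k _
    exact div_nonneg (tsum_nonneg fun _ => by positivity) (tsum_nonneg fun _ => by positivity)
  · intro k hk hk2
    have hkpos : (0 : ℝ) < k := hKpos.trans_le hk
    have hfl : (⌊M / 2⌋₊ : ℝ) ≤ M / 2 := Nat.floor_le (by linarith)
    have hM0 : 0 < M := by linarith
    have hTk : (k : ℝ) / M = (p : ℝ) ^ (s + 1) * (k / x) := by rw [hM]; field_simp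
    have hT1 : T ≤ k / M := by
      rwa [le_div_iff₀ hM0, mul_comm, ← hKMT]
    have hT2 : k / M ≤ T + 1 := by
      rw [div_le_iff₀ hM0, add_mul, one_mul, mul_comm T, ← hKMT]; linarith only [hk2, hfl]
    have hmain := le_tail_div_tsum hp2 s (div_pos hkpos hx0) hTk (by linarith)
    rw [← hqk] at hmain
    refine le_trans ?_ hmain
    have hprod := prod_one_add_div_pow_le_exp hp2 (by linarith : 0 ≤ k / M)
      (by linarith : 1 + k / M ≤ L) (by linarith) s
    have hT0 : 0 ≤ T := by linarith
    have hprod0 : 0 < ∏ j ∈ Finset.range s, (1 + k / M / (p : ℝ) ^ (j + 1)) :=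
      Finset.prod_pos fun _ _ => by positivity
    gcongr
end

section
/- There exists an absolute constant N₀ such that the following holds for all N ≥ N₀ and every prime p with p ≤ (log N)/(log log N)². Set r = ⌊(log N)/(2·e·p)⌋, x = √(6N)/π, and K = (√(6N)/(2π·p^r))·(log N)·(1 + 1/(5p)). Then ∑_{K ≤ k ≤ K + x/p^r, gcd(k,p)=1} e^(−p^r·k/x)·(x/k) ≥ 1/(20 · N^(1/(10p)) · log N), where the sum is over positive integers k in the interval [K, K + x/p^r] coprime to p. -/
/-- An interval of length `y` starting at `K ≥ 0` contains at least `y / 2 - 1` integers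
coprime to a given prime, since two consecutive integers are not both divisible by it. -/
lemma exists_finset_coprime_card_ge {p : ℕ} (hp : p.Prime) {K y : ℝ} (hK : 0 ≤ K) :
    ∃ s : Finset ℕ, (∀ k ∈ s, K ≤ (k : ℝ) ∧ (k : ℝ) ≤ K + y ∧ Nat.Coprime k p) ∧
      y / 2 - 1 ≤ (s.card : ℝ) := by
  set a : ℕ := ⌈K⌉₊
  have ha₁ : K ≤ a := Nat.le_ceil K
  have ha₂ : (a : ℝ) < K + 1 := Nat.ceil_lt_add_one hK
  let g : ℕ → ℕ := fun i => if Nat.Coprime (a + 2 * i) p then a + 2 * i else a + 2 * i + 1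
  have hg_ge (i : ℕ) : a + 2 * i ≤ g i := by simp only [g]; split_ifs <;> omega
  have hg_le (i : ℕ) : g i ≤ a + 2 * i + 1 := by simp only [g]; split_ifs <;> omega
  have hg_coprime (i : ℕ) : Nat.Coprime (g i) p := by
    simp only [g]
    split_ifs with h
    · exact h
    · have h_dvd : p ∣ a + 2 * i := by
        by_contra hnd
        exact h ((hp.coprime_iff_not_dvd.mpr hnd).symm)
      refine (hp.coprime_iff_not_dvd.mpr fun h' => ?_).symm
      exact hp.one_lt.ne' (Nat.dvd_one.mp ((Nat.dvd_add_right h_dvd).mp h'))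
  have hg_inj : Function.Injective g := by
    intro i j hij
    have h₁ := hg_ge i
    have h₂ := hg_le i
    have h₃ := hg_ge j
    have h₄ := hg_le j
    omega
  refine ⟨(Finset.range ⌊y / 2⌋₊).image g, ?_, ?_⟩
  · intro k hk
    obtain ⟨i, hi, rfl⟩ := Finset.mem_image.mp hk
    rw [Finset.mem_range] at hi
    have h_pos : 0 < ⌊y / 2⌋₊ := by omega
    have h_floor : (⌊y / 2⌋₊ : ℝ) ≤ y / 2 :=
      Nat.floor_le (le_trans zero_le_one (Nat.floor_pos.mp h_pos))
    have hi' : (i : ℝ) + 1 ≤ ⌊y / 2⌋₊ := by exact_mod_cast hi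
    have h₁ : (a : ℝ) + 2 * i ≤ g i := by exact_mod_cast hg_ge i
    have h₂ : (g i : ℝ) ≤ a + 2 * i + 1 := by exact_mod_cast hg_le i
    have h₃ : (0 : ℝ) ≤ i := i.cast_nonneg
    exact ⟨by linarith, by linarith, hg_coprime i⟩
  · rw [Finset.card_image_of_injective _ hg_inj, Finset.card_range]
    exact (Nat.sub_one_lt_floor _).le

/-- A sum of nonnegative terms over the integers of `[a, b]` with a given property is at least
the sum over any finite set of such integers. -/
lemma sum_le_tsum_subtype_Icc {a b : ℝ} {Q : ℕ → Prop} {f : ℕ → ℝ} (hf : ∀ k, 0 ≤ f k)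
    {s : Finset ℕ} (hs : ∀ k ∈ s, a ≤ (k : ℝ) ∧ (k : ℝ) ≤ b ∧ Q k) :
    ∑ k ∈ s, f k ≤ ∑' k : {k : ℕ // a ≤ (k : ℝ) ∧ (k : ℝ) ≤ b ∧ Q k}, f k := by
  set S : Set ℕ := {k : ℕ | a ≤ (k : ℝ) ∧ (k : ℝ) ≤ b ∧ Q k}
  have h_fin : S.Finite :=
    (Set.finite_Iic ⌊b⌋₊).subset fun k hk => Nat.le_floor hk.2.1
  have h_tsum : ∑' k : {k : ℕ // a ≤ (k : ℝ) ∧ (k : ℝ) ≤ b ∧ Q k}, f k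
      = ∑' k, S.indicator f k := tsum_subtype S f
  rw [h_tsum]
  calc ∑ k ∈ s, f k = ∑ k ∈ s, S.indicator f k :=
        Finset.sum_congr rfl fun k hk => (Set.indicator_of_mem (s := S) (hs k hk) f).symm
    _ ≤ ∑' k, S.indicator f k :=
        (summable_of_hasFiniteSupport (h_fin.subset Set.support_indicator_subset)).sum_le_tsum s
          fun k _ => Set.indicator_nonneg (fun k _ => hf k) k

lemma three_quarters_mul_sqrt_le (t : ℝ) :
    3 / 4 * √t ≤ √(6 * t) / Real.pi := by
  rw [Real.sqrt_mul (by norm_num), le_div_iff₀ Real.pi_pos]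
  have h₁ : (2.4 : ℝ) ≤ √6 := Real.le_sqrt_of_sq_le (by norm_num)
  have h₂ := Real.pi_lt_d2
  have h₃ := Real.sqrt_nonneg t
  nlinarith

lemma pow_floor_log_div_le {N p : ℕ} (hN : 1 ≤ N) (hp : 0 < p) :
    (p : ℝ) ^ ⌊Real.log N / (2 * Real.exp 1 * p)⌋₊ ≤ (N : ℝ) ^ (1 / 4 : ℝ) := by
  have hp' : (0 : ℝ) < p := by exact_mod_cast hp
  have hN' : (0 : ℝ) < N := by exact_mod_cast hN
  have hL : 0 ≤ Real.log N := Real.log_natCast_nonneg N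
  have h_floor := Nat.floor_le (a := Real.log N / (2 * Real.exp 1 * p)) (by positivity)
  have h_log : Real.log p ≤ p := Real.log_le_self hp'.le
  have h_exp : (2 : ℝ) ≤ Real.exp 1 := by linarith [Real.add_one_le_exp (1 : ℝ)]
  rw [← Real.log_le_log_iff (by positivity) (by positivity), Real.log_pow, Real.log_rpow hN']
  calc (⌊Real.log N / (2 * Real.exp 1 * p)⌋₊ : ℝ) * Real.log p
      ≤ Real.log N / (2 * Real.exp 1 * p) * p := by gcongr
    _ = Real.log N / (2 * Real.exp 1) := by field_simp
    _ ≤ Real.log N / (2 * 2) := by gcongr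
    _ = 1 / 4 * Real.log N := by ring

/-- There exists an absolute constant `N₀` such that for all `N ≥ N₀` and
every prime `p ≤ (log N)/(log log N)²`, with `r = ⌊(log N)/(2ep)⌋`, `x = √(6N)/π` and
`K = (√(6N)/(2π·p^r))·(log N)·(1 + 1/(5p))`, one has
`∑_{K ≤ k ≤ K + x/p^r, (k,p)=1} e^(−p^r·k/x)·(x/k) ≥ 1/(20·N^(1/(10p))·log N)`. -/
theorem short_sum_lower_bound :
    ∃ N₀ : ℕ, ∀ N : ℕ, N₀ ≤ N → ∀ p : ℕ, p.Prime →
      (p : ℝ) ≤ Real.log N / (Real.log (Real.log N)) ^ 2 →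
      ∀ r : ℕ, r = ⌊Real.log N / (2 * Real.exp 1 * p)⌋₊ →
      ∀ x : ℝ, x = Real.sqrt (6 * N) / Real.pi →
      ∀ K : ℝ, K = Real.sqrt (6 * N) / (2 * Real.pi * (p : ℝ) ^ r) * Real.log N *
        (1 + 1 / (5 * (p : ℝ))) →
      1 / (20 * (N : ℝ) ^ ((1 : ℝ) / (10 * (p : ℝ))) * Real.log N) ≤
        ∑' k : {k : ℕ // K ≤ (k : ℝ) ∧ (k : ℝ) ≤ K + x / (p : ℝ) ^ r ∧ Nat.Coprime k p},
          Real.exp (-(p : ℝ) ^ r * ((k : ℕ) : ℝ) / x) * (x / ((k : ℕ) : ℝ)) := by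
  refine ⟨10 ^ 4, ?_⟩
  intro N hN p hp _ r hr x hx K hK
  have hN₁ : (10 : ℝ) ^ 4 ≤ N := by exact_mod_cast hN
  have hN₀ : (0 : ℝ) < N := by linarith
  have hp₂ : (2 : ℝ) ≤ p := by exact_mod_cast hp.two_le
  set L := Real.log N with hL
  have hL₂ : 2 ≤ L := by
    rw [hL, Real.le_log_iff_exp_le hN₀, show (2 : ℝ) = 1 + 1 by norm_num, Real.exp_add]
    nlinarith [Real.exp_one_lt_d9, Real.exp_pos 1]
  set δ : ℝ := 1 / (5 * (p : ℝ)) with hδ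
  have hδ₀ : 0 < δ := by positivity
  have hδ₁ : δ ≤ 1 / 10 := by
    rw [hδ]; exact one_div_le_one_div_of_le (by norm_num) (by linarith)
  have hP : (0 : ℝ) < (p : ℝ) ^ r := by positivity
  have hsqrt : 0 < √(N : ℝ) := Real.sqrt_pos.mpr hN₀
  have hx_ge : 3 / 4 * √(N : ℝ) ≤ x := hx ▸ three_quarters_mul_sqrt_le N
  have hx₀ : 0 < x := by linarith
  set y := x / (p : ℝ) ^ r with hy
  have hy₀ : 0 < y := by positivity
  have hxy : x = y * (p : ℝ) ^ r := by rw [hy]; field_simp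
  have hKy : K = y * (L * (1 + δ) / 2) := by
    rw [hK, hy, hx]; field_simp
  have hK₀ : 0 < K := by rw [hKy]; positivity
  have hy₄ : 4 ≤ y := by
    have h_quarter : (10 : ℝ) ≤ (N : ℝ) ^ (1 / 4 : ℝ) := by
      calc (10 : ℝ) = ((10 : ℝ) ^ 4) ^ (1 / 4 : ℝ) := by
            rw [← Real.rpow_natCast, ← Real.rpow_mul (by norm_num)]; norm_num
        _ ≤ (N : ℝ) ^ (1 / 4 : ℝ) := by gcongr
    have h_sqrt : √(N : ℝ) = (N : ℝ) ^ (1 / 4 : ℝ) * (N : ℝ) ^ (1 / 4 : ℝ) := by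
      rw [Real.sqrt_eq_rpow, ← Real.rpow_add hN₀]; norm_num
    have h_pow : (p : ℝ) ^ r ≤ (N : ℝ) ^ (1 / 4 : ℝ) := by
      rw [hr]; exact pow_floor_log_div_le (by omega) hp.pos
    rw [hy, le_div_iff₀ hP]
    nlinarith
  obtain ⟨s, hs, hs_card⟩ := exists_finset_coprime_card_ge hp (y := y) hK₀.le
  set E : ℝ := (N : ℝ) ^ ((1 : ℝ) / (10 * (p : ℝ))) with hE
  have hE₀ : 0 < E := by positivity
  have h_exp : Real.exp (-(L * (1 + δ) / 2 + 1)) = Real.exp (-1) / (√(N : ℝ) * E) := by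
    rw [hE, Real.sqrt_eq_rpow, ← Real.rpow_add hN₀, Real.rpow_def_of_pos hN₀, ← Real.exp_sub]
    congr 1
    rw [hδ]
    field_simp
    ring
  have h_exp_one : (1 : ℝ) / 3 ≤ Real.exp (-1) := by
    rw [Real.exp_neg, ← one_div]
    exact one_div_le_one_div_of_le (Real.exp_pos 1) (by linarith [Real.exp_one_lt_d9])
  have h_term : ∀ k ∈ s, Real.exp (-1) / (√(N : ℝ) * E) * (x / (y * (L * (1 + δ) / 2 + 1))) ≤
      Real.exp (-(p : ℝ) ^ r * (k : ℝ) / x) * (x / (k : ℝ)) := by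
    intro k hk
    obtain ⟨hk₁, hk₂, -⟩ := hs k hk
    have hk₀ : (0 : ℝ) < k := hK₀.trans_le hk₁
    have hk₃ : (k : ℝ) ≤ y * (L * (1 + δ) / 2 + 1) := by rw [hKy] at hk₂; linarith
    rw [← h_exp]
    gcongr
    have h_eq : -(p : ℝ) ^ r * (k : ℝ) / x = -(k / y) := by rw [hxy]; field_simp
    rw [h_eq, neg_le_neg_iff, div_le_iff₀ hy₀]
    linarith
  refine le_trans ?_ (sum_le_tsum_subtype_Icc
    (f := fun k : ℕ => Real.exp (-(p : ℝ) ^ r * (k : ℝ) / x) * (x / (k : ℝ)))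
    (fun k => by positivity) hs)
  refine le_trans ?_ (Finset.card_nsmul_le_sum s _ _ h_term)
  rw [nsmul_eq_mul]
  calc 1 / (20 * E * L)
      ≤ (y / 4) * ((1 / 3) / (√(N : ℝ) * E) * (3 / 4 * √(N : ℝ) / (y * (5 / 4 * L)))) := by
        apply le_of_eq
        field_simp
        norm_num
    _ ≤ s.card * (Real.exp (-1) / (√(N : ℝ) * E) * (x / (y * (L * (1 + δ) / 2 + 1)))) := by
        have h_card : y / 4 ≤ s.card := by linarith
        have h_le : L * (1 + δ) / 2 + 1 ≤ 5 / 4 * L := by nlinarith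
        clear hx hxy hKy hK
        gcongr
end
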